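/- arXiv:1612.00426 — 3 statements merged into one kernel-verified Lean document; each statement's English description precedes it below -/
import Mathlib

section
/- For any subset J of [n-1], the sum over permutations w in S_n with Des(w) = J of x^{des(w^{-1})} q^{maj(w^{-1})} equals the sum over the same set of x^{stc(w)} q^{inv(w)}. -/
open Finset

/-- Descent set of a word (1-based positions: `i ∈ desSet w` iff `1 ≤ i ≤ n-1` and `w_i > w_{i+1}`). -/
def desSet {α : Type*} [LinearOrder α] {n : ℕ} (w : Fin n → α) : Finset ℕ :=
  (Finset.Ico 1 n).filter fun i =>
    ∃ h : i < n, w ⟨i, h⟩ < w ⟨i - 1, Nat.lt_of_le_of_lt (Nat.sub_le i 1) h⟩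

def desStat {α : Type*} [LinearOrder α] {n : ℕ} (w : Fin n → α) : ℕ := (desSet w).card

def majStat {α : Type*} [LinearOrder α] {n : ℕ} (w : Fin n → α) : ℕ := ∑ i ∈ desSet w, i

def invStat {α : Type*} [LinearOrder α] {n : ℕ} (w : Fin n → α) : ℕ :=
  ((Finset.univ : Finset (Fin n × Fin n)).filter fun p => p.1 < p.2 ∧ w p.2 < w p.1).card

/-- Lehmer code. -/
def lehmer {α : Type*} [LinearOrder α] {n : ℕ} (w : Fin n → α) (i : Fin n) : ℕ :=
  (Finset.univ.filter fun j => i < j ∧ w j < w i).card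

/-- `c` contains a subsequence of length `r` which is entrywise strictly greater than
the staircase `(r-1, r-2, ..., 1, 0)`, i.e. the entry at (1-based) place `k` exceeds `r - k`. -/
def hasStaircase {n : ℕ} (c : Fin n → ℕ) (r : ℕ) : Prop :=
  ∃ f : Fin r → Fin n, StrictMono f ∧ ∀ k : Fin r, r < c (f k) + (k : ℕ) + 1

noncomputable def stcWord {n : ℕ} (c : Fin n → ℕ) : ℕ := sSup {r | hasStaircase c r}

noncomputable def stcStat {α : Type*} [LinearOrder α] {n : ℕ} (w : Fin n → α) : ℕ := stcWord (lehmer w)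

noncomputable abbrev PP := Polynomial (Polynomial ℤ)
noncomputable def xP : PP := Polynomial.X
noncomputable def qP : PP := Polynomial.C Polynomial.X

/-- code side transfer function -/
noncomputable def KK (W : ℕ → PP) : ℕ → ℕ → ℕ → PP
  | 0, _, r => W r
  | a + 1, v, r => ∑ c ∈ range (v + 1), qP ^ c * KK W a c (if r < c then r + 1 else r)

/-- effect on the descent set of inserting a new minimum after `p` letters -/
def insD (p : ℕ) (D : Finset ℕ) : Finset ℕ :=
  (D.filter (· < p) ∪ (if p = 0 then ∅ else {p})) ∪ (D.filter (p < ·)).image (· + 1)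

/-- word side transfer function -/
noncomputable def GG (W : ℕ → PP) : ℕ → ℕ → Finset ℕ → PP
  | 0, _, D => qP ^ (∑ i ∈ D, i) * W D.card
  | a + 1, v, D => ∑ p ∈ range (v + 1), GG W a p (insD p D)

theorem KK_zero (W : ℕ → PP) (a r : ℕ) : KK W a 0 r = W r := by
  induction a generalizing r with
  | zero => rfl
  | succ a ih => simp [KK, ih]

theorem KK_shift (W : ℕ → PP) (a b r : ℕ) :
    KK W (a + 1) (b + 1) (r + 1) =
      KK W a (b + 1) (r + 1) + qP ^ (a + 1) * KK (fun i => W (i + 1)) (a + 1) b r := by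
  induction a generalizing b r with
  | zero =>
    simp only [KK]
    rw [sum_range_succ', mul_sum, add_comm]
    have e : ∀ c : ℕ, qP ^ (c + 1) * W (if r + 1 < c + 1 then r + 1 + 1 else r + 1) =
        qP ^ (0 + 1) * (qP ^ c * W ((if r < c then r + 1 else r) + 1)) := by
      intro c
      by_cases h : r < c
      · rw [if_pos h, if_pos (by omega)]; ring
      · rw [if_neg h, if_neg (by omega)]; ring
    simp only [e, pow_zero, one_mul, not_lt_zero, if_false]
  | succ a ih =>
    have e : ∀ c r : ℕ, (if r + 1 < c + 1 then r + 1 + 1 else r + 1) = (if r < c then r + 1 else r) + 1 := by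
      intro c r; by_cases h : r < c <;> simp [h]
    rw [KK, sum_range_succ']
    conv_rhs => rw [KK, KK, sum_range_succ']
    simp only [e, ih, KK_zero, mul_add, sum_add_distrib, mul_sum]
    have : ∀ c : ℕ, qP ^ (c + 1) * (qP ^ (a + 1) * KK (fun i => W (i + 1)) (a + 1) c (if r < c then r + 1 else r))
      = qP ^ (a + 1 + 1) * (qP ^ c * KK (fun i => W (i + 1)) (a + 1) c (if r < c then r + 1 else r)) := by
      intro c; ring
    simp only [this]
    ring

theorem insD_sum (p : ℕ) (D : Finset ℕ) (F : ℕ → ℕ) :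
    ∑ i ∈ insD p D, F i = ∑ i ∈ D.filter (· < p), F i + (if p = 0 then 0 else F p)
      + ∑ i ∈ D.filter (p < ·), F (i + 1) := by
  unfold insD
  rw [sum_union, sum_union, sum_image]
  · split_ifs <;> simp
  · intro a _ b _ h; simpa using h
  · split_ifs <;> simp
  · rw [disjoint_left]
    intro x hx
    simp only [mem_union, mem_filter, mem_image, not_exists, not_and] at *
    rintro y ⟨_, hy⟩ rfl
    rcases hx with hx | hx
    · omega
    · split_ifs at hx <;> simp at hx
      omega

theorem zero_notMem_insD (p : ℕ) (D : Finset ℕ) (h : 0 ∉ D) : 0 ∉ insD p D := by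
  unfold insD
  by_cases hp : p = 0 <;> simp [hp, h]
  omega

theorem insD_filter_lt (p : ℕ) (D : Finset ℕ) :
    (insD p D).filter (p < ·) = (D.filter (p < ·)).image (· + 1) := by
  ext x
  unfold insD
  by_cases hp : p = 0
  · simp [hp]; intros; omega
  · simp [hp]
    constructor
    · rintro ⟨h | h | h, h'⟩
      · omega
      · omega
      · exact h
    · rintro ⟨a, ⟨h1, h2⟩, rfl⟩
      exact ⟨Or.inr (Or.inr ⟨a, ⟨h1, h2⟩, rfl⟩), by omega⟩

theorem insD_filter_lt_card (p : ℕ) (D : Finset ℕ) :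
    ((insD p D).filter (p < ·)).card = (D.filter (p < ·)).card := by
  rw [insD_filter_lt, card_image_of_injective]
  intro a b h; simpa using h

theorem insD_filter_le_card (p : ℕ) (hp : p ≠ 0) (D : Finset ℕ) :
    ((insD p D).filter (· ≤ p)).card = (D.filter (· < p)).card + 1 := by
  have : (insD p D).filter (· ≤ p) = insert p (D.filter (· < p)) := by
    ext x
    simp only [insD, hp, if_false, mem_filter, mem_union, mem_singleton, mem_image, mem_insert]
    constructor
    · rintro ⟨(h | h) | ⟨a, h, rfl⟩, h'⟩
      · exact Or.inr h
      · exact Or.inl h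
      · omega
    · rintro (h | h)
      · exact ⟨Or.inl (Or.inr h), h.le⟩
      · exact ⟨Or.inl (Or.inl h), h.2.le⟩
  rw [this, card_insert_of_notMem (by simp)]

theorem insD_sum_id (p : ℕ) (D : Finset ℕ) (h0 : 0 ∉ D) :
    ∑ i ∈ insD p D, i + (if p ∈ D then p else 0) =
      ∑ i ∈ D, i + p + (D.filter (p < ·)).card := by
  have h1 := insD_sum p D (fun i => i)
  simp only [sum_add_distrib, sum_const, smul_eq_mul, mul_one] at h1
  have h2 := sum_filter_add_sum_filter_not D (· < p) (fun i => i)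
  have h3 := sum_filter_add_sum_filter_not (D.filter (fun x => ¬ x < p)) (p < ·) (fun i => i)
  have h4 : (D.filter (fun x => ¬ x < p)).filter (p < ·) = D.filter (p < ·) := by
    ext x; by_cases hx : x ∈ D <;> simp [hx]; omega
  have h5 : (D.filter (fun x => ¬ x < p)).filter (fun x => ¬ p < x) = D.filter (p = ·) := by
    ext x; by_cases hx : x ∈ D <;> simp [hx]; omega
  rw [h4, h5, filter_eq] at h3
  have h6 : (if p = 0 then 0 else p) = p := by split_ifs <;> omega
  by_cases hp : p ∈ D <;> simp only [hp, if_true, if_false, sum_singleton, sum_empty] at h3 ⊢ <;> omega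

theorem GG_eq (W : ℕ → PP) (a v : ℕ) (D : Finset ℕ) (h0 : 0 ∉ D) :
    GG W a v D = qP ^ (∑ i ∈ D, i + a * (D.filter (v < ·)).card) *
      KK (fun i => W (i + (D.filter (v < ·)).card)) a v (D.filter (· ≤ v)).card := by
  induction a generalizing v D with
  | zero =>
    simp only [GG, KK]
    have := card_filter_add_card_filter_not (s := D) (· ≤ v)
    simp only [not_le] at this
    simp [this]
  | succ a ih =>
    have z : D.filter (· ≤ 0) = ∅ := by
      ext x; simp; intro hx; 
      exact fun h => h0 (h ▸ hx)
    have z' : D.filter (0 < ·) = D := by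
      ext x; simp; intro hx
      exact Nat.pos_of_ne_zero fun h => h0 (h ▸ hx)
    induction v with
    | zero =>
      have e1 := insD_sum_id 0 D h0
      have e2 := insD_filter_lt_card 0 D
      simp only [GG, zero_add, range_one, sum_singleton]
      rw [ih _ _ (zero_notMem_insD 0 D h0), KK_zero, KK_zero, e2, z, z']
      simp only [z', h0, if_false] at e1
      have e3 : (insD 0 D).filter (· ≤ 0) = ∅ := by
        ext x; simp; intro hx; 
        exact fun h => zero_notMem_insD 0 D h0 (h ▸ hx)
      rw [e3]
      congr 2
      rw [← Nat.add_zero (∑ i ∈ insD 0 D, i), e1]; ring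
    | succ v ihv =>
      have r1 : GG W (a + 1) (v + 1) D = GG W (a + 1) v D + GG W a (v + 1) (insD (v + 1) D) := by
        rw [GG, sum_range_succ, ← GG]
      have r2 := insD_sum_id (v + 1) D h0
      have r3 := insD_filter_lt_card (v + 1) D
      have r4 := insD_filter_le_card (v + 1) (by simp) D
      simp only [Nat.lt_succ_iff] at r4
      rw [r1, ihv, ih _ _ (zero_notMem_insD _ D h0), r3, r4]
      by_cases hv : v + 1 ∈ D
      · have c1 : (D.filter (v < ·)).card = (D.filter (v + 1 < ·)).card + 1 := by
          have : D.filter (v < ·) = insert (v + 1) (D.filter (v + 1 < ·)) := by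
            ext x
            simp only [mem_filter, mem_insert]
            constructor
            · rintro ⟨h, h'⟩
              rcases Nat.eq_or_lt_of_le h' with h'' | h''
              · left; omega
              · right; exact ⟨h, h''⟩
            · rintro (rfl | h)
              · exact ⟨hv, by omega⟩
              · exact ⟨h.1, by omega⟩
          rw [this, card_insert_of_notMem (by simp)]
        have c2 : (D.filter (· ≤ v + 1)).card = (D.filter (· ≤ v)).card + 1 := by
          have : D.filter (· ≤ v + 1) = insert (v + 1) (D.filter (· ≤ v)) := by
            ext x
            simp only [mem_filter, mem_insert]
            constructor
            · rintro ⟨h, h'⟩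
              rcases Nat.eq_or_lt_of_le h' with h'' | h''
              · left; omega
              · right; exact ⟨h, by omega⟩
            · rintro (rfl | h)
              · exact ⟨hv, by omega⟩
              · exact ⟨h.1, by omega⟩
          rw [this, card_insert_of_notMem (by simp)]
        simp only [hv, if_true] at r2
        have r2' : ∑ i ∈ insD (v + 1) D, i = ∑ i ∈ D, i + (D.filter (v + 1 < ·)).card := by omega
        rw [r2', c1, c2, KK_shift]
        have : (fun i => W (i + ((D.filter (v + 1 < ·)).card + 1))) =
          (fun i => W (i + 1 + (D.filter (v + 1 < ·)).card)) := by
          funext i; congr 1; ring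
        rw [this]
        ring
      · have c1 : D.filter (v < ·) = D.filter (v + 1 < ·) := by
          ext x
          simp only [mem_filter]
          constructor
          · rintro ⟨h, h'⟩
            refine ⟨h, lt_of_le_of_ne h' ?_⟩
            rintro rfl; exact hv h
          · rintro ⟨h, h'⟩; exact ⟨h, by omega⟩
        have c2 : D.filter (· ≤ v + 1) = D.filter (· ≤ v) := by
          ext x
          simp only [mem_filter]
          constructor
          · rintro ⟨h, h'⟩
            refine ⟨h, Nat.lt_succ_iff.1 (lt_of_le_of_ne h' ?_)⟩
            rintro rfl; exact hv h
          · rintro ⟨h, h'⟩; exact ⟨h, by omega⟩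
        simp only [hv, if_false] at r2
        have r2' : ∑ i ∈ insD (v + 1) D, i = ∑ i ∈ D, i + (v + 1) + (D.filter (v + 1 < ·)).card := by omega
        have hk : (D.filter (· ≤ v)).card < v + 1 := by
          have : D.filter (· ≤ v) ⊆ Ioc 0 v := by
            intro x hx
            simp only [mem_filter, mem_Ioc] at *
            exact ⟨Nat.pos_of_ne_zero fun h => h0 (h ▸ hx.1), hx.2⟩
          have := card_le_card this
          simp at this; omega
        have r5 : ∀ W' : ℕ → PP, KK W' (a + 1) (v + 1) (D.filter (· ≤ v)).card =
            KK W' (a + 1) v (D.filter (· ≤ v)).card +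
              qP ^ (v + 1) * KK W' a (v + 1) ((D.filter (· ≤ v)).card + 1) := by
          intro W'
          rw [KK, sum_range_succ, ← KK, if_pos hk]
        rw [r2', c1, c2, r5]
        ring

theorem GG_top (W : ℕ → PP) (a v : ℕ) (D : Finset ℕ) (h : D ⊆ Ico 1 (v + 1)) :
    GG W a v D = GG (fun r => KK W a v r) 0 0 D := by
  have h0 : 0 ∉ D := fun h' => by simpa using h h'
  rw [GG_eq _ _ _ _ h0]
  have e1 : D.filter (v < ·) = ∅ := by
    ext x; simp; intro hx; have := h hx; simp at this; omega
  have e2 : D.filter (· ≤ v) = D := by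
    ext x; simp; intro hx; have := h hx; simp at this; omega
  simp [e1, e2, GG]

/-! ### staircases -/

theorem hasStaircase_le {n : ℕ} {c : Fin n → ℕ} {r : ℕ} (h : hasStaircase c r) : r ≤ n := by
  obtain ⟨f, hf, _⟩ := h
  simpa using Fintype.card_le_of_injective f hf.injective

theorem hasStaircase_zero {n : ℕ} (c : Fin n → ℕ) : hasStaircase c 0 :=
  ⟨fun k => k.elim0, fun k => k.elim0, fun k => k.elim0⟩

theorem hasStaircase_pred {n : ℕ} {c : Fin n → ℕ} {r : ℕ} (h : hasStaircase c (r + 1)) :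
    hasStaircase c r := by
  obtain ⟨f, hf, hc⟩ := h
  refine ⟨fun k => f k.succ, fun a b hab => hf (by simpa using hab), fun k => ?_⟩
  have := hc k.succ
  simp at this
  omega

theorem hasStaircase_iff {n : ℕ} (c : Fin n → ℕ) (r : ℕ) : hasStaircase c r ↔ r ≤ stcWord c := by
  have hb : BddAbove {r | hasStaircase c r} := ⟨n, fun r h => hasStaircase_le h⟩
  constructor
  · intro h; exact le_csSup hb h
  · intro h
    have hm : hasStaircase c (stcWord c) := Nat.sSup_mem ⟨0, hasStaircase_zero c⟩ hb
    exact Nat.decreasingInduction' (P := fun r => hasStaircase c r)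
      (fun k _ _ hk => hasStaircase_pred hk) h hm

theorem hasStaircase_cons {n : ℕ} (c : Fin (n + 1) → ℕ) (r : ℕ) :
    hasStaircase c (r + 1) ↔ hasStaircase (fun i => c i.succ) (r + 1) ∨
      (r < c 0 ∧ hasStaircase (fun i => c i.succ) r) := by
  constructor
  · rintro ⟨f, hf, hc⟩
    have hpos : ∀ k : Fin r, f k.succ ≠ 0 := fun k h => by
      have := hf (Fin.succ_pos k)
      rw [h] at this
      exact absurd this (by simp)
    by_cases h : f 0 = 0
    · right
      have h0 := hc 0
      rw [h] at h0
      simp at h0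
      refine ⟨h0, fun k => (f k.succ).pred (hpos k), fun a b hab => ?_, fun k => ?_⟩
      · simpa using hf (by simpa using hab)
      · have := hc k.succ
        simp at this ⊢
        omega
    · left
      have hp : ∀ k, f k ≠ 0 := fun k => by
        refine Fin.cases h hpos k
      refine ⟨fun k => (f k).pred (hp k), fun a b hab => ?_, fun k => ?_⟩
      · simpa using hf (by simpa using hab)
      · simpa using hc k
  · rintro (⟨f, hf, hc⟩ | ⟨h, f, hf, hc⟩)
    · exact ⟨fun k => (f k).succ, fun a b hab => by simpa using hf hab, hc⟩
    · refine ⟨Fin.cons 0 (fun k => (f k).succ), ?_, ?_⟩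
      · intro a b hab
        induction b using Fin.cases with
        | zero => simp at hab
        | succ b =>
          induction a using Fin.cases with
          | zero => simp
          | succ a => simpa using hf (by simpa using hab)
      · intro k
        induction k using Fin.cases with
        | zero => simpa using h
        | succ k => have := hc k; simp; omega

theorem stcWord_cons {n : ℕ} (c : Fin (n + 1) → ℕ) :
    stcWord c = if stcWord (fun i => c i.succ) < c 0 then stcWord (fun i => c i.succ) + 1
      else stcWord (fun i => c i.succ) := by
  apply eq_of_forall_le_iff
  intro r
  cases r with
  | zero => simp
  | succ r =>
    rw [← hasStaircase_iff, hasStaircase_cons, hasStaircase_iff, hasStaircase_iff]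
    split_ifs <;> omega

/-! ### permutations -/

/-- prepend the letter `p` to `σ` -/
def consP {n : ℕ} (p : Fin (n + 1)) (σ : Equiv.Perm (Fin n)) : Equiv.Perm (Fin (n + 1)) :=
  (finSuccEquiv' 0).trans ((Equiv.optionCongr σ).trans (finSuccEquiv' p).symm)

@[simp] theorem consP_zero {n : ℕ} (p : Fin (n + 1)) (σ : Equiv.Perm (Fin n)) :
    consP p σ 0 = p := by
  simp [consP]

@[simp] theorem consP_succ {n : ℕ} (p : Fin (n + 1)) (σ : Equiv.Perm (Fin n)) (i : Fin n) :
    consP p σ i.succ = p.succAbove (σ i) := by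
  have : finSuccEquiv' (0 : Fin (n + 1)) i.succ = some i := by
    rw [← Fin.zero_succAbove]; exact finSuccEquiv'_succAbove 0 i
  simp [consP, this]

theorem consP_inv_self {n : ℕ} (p : Fin (n + 1)) (σ : Equiv.Perm (Fin n)) :
    (consP p σ)⁻¹ p = 0 := by
  rw [Equiv.Perm.inv_eq_iff_eq]; simp

theorem consP_inv_succAbove {n : ℕ} (p : Fin (n + 1)) (σ : Equiv.Perm (Fin n)) (i : Fin n) :
    (consP p σ)⁻¹ (p.succAbove i) = (σ⁻¹ i).succ := by
  rw [Equiv.Perm.inv_eq_iff_eq]; simp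

theorem consP_bij (n : ℕ) :
    Function.Bijective (fun x : Equiv.Perm (Fin n) × Fin (n + 1) => consP x.2 x.1) := by
  rw [Fintype.bijective_iff_injective_and_card]
  constructor
  · rintro ⟨σ, p⟩ ⟨τ, s⟩ h
    simp only at h
    have h1 : p = s := by simpa using congrArg (fun w => w 0) h
    subst h1
    have h2 : σ = τ := by
      ext i
      have := congrArg (fun w => w i.succ) h
      simp at this
      rw [this]
    rw [h2]
  · simp [Fintype.card_perm, Nat.factorial_succ, mul_comm]

theorem lehmer_consP_zero {n : ℕ} (p : Fin (n + 1)) (σ : Equiv.Perm (Fin n)) :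
    lehmer (fun i => consP p σ i) 0 = p := by
  unfold lehmer
  have : (univ.filter fun j : Fin (n + 1) => 0 < j ∧ consP p σ j < consP p σ 0) =
      (univ.filter fun j : Fin (n + 1) => j < p).image (fun i => (consP p σ)⁻¹ i) := by
    ext j
    simp only [mem_filter, mem_univ, true_and, mem_image, consP_zero]
    constructor
    · rintro ⟨_, h⟩; exact ⟨_, h, by simp⟩
    · rintro ⟨k, hk, rfl⟩
      have e : consP p σ ((consP p σ)⁻¹ k) = k := by simp
      rw [e]
      refine ⟨?_, hk⟩
      rw [Fin.pos_iff_ne_zero, Ne, Equiv.Perm.inv_eq_iff_eq]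
      simp [hk.ne]
  rw [this, card_image_of_injective _ (Equiv.injective _)]
  rw [filter_gt_eq_Iio, Fin.card_Iio]

theorem lehmer_consP_succ {n : ℕ} (p : Fin (n + 1)) (σ : Equiv.Perm (Fin n)) (i : Fin n) :
    lehmer (fun i => consP p σ i) i.succ = lehmer (fun i => σ i) i := by
  unfold lehmer
  rw [← card_image_of_injective (univ.filter fun j : Fin n => i < j ∧ σ j < σ i) (Fin.succ_injective n)]
  congr 1
  ext j
  induction j using Fin.cases with
  | zero => simp
  | succ j => simp [Fin.succAbove_lt_succAbove_iff]

theorem stc_consP {n : ℕ} (p : Fin (n + 1)) (σ : Equiv.Perm (Fin n)) :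
    stcStat (fun i => consP p σ i) =
      if stcStat (fun i => σ i) < p then stcStat (fun i => σ i) + 1 else stcStat (fun i => σ i) := by
  unfold stcStat
  rw [stcWord_cons, lehmer_consP_zero]
  simp only [lehmer_consP_succ]

theorem invStat_eq {n : ℕ} (w : Fin n → Fin n) : invStat w = ∑ i, lehmer w i := by
  unfold invStat lehmer
  simp only [card_filter]
  rw [← univ_product_univ, sum_product]

theorem inv_consP {n : ℕ} (p : Fin (n + 1)) (σ : Equiv.Perm (Fin n)) :
    invStat (fun i => consP p σ i) = p + invStat (fun i => σ i) := by
  rw [invStat_eq, invStat_eq, Fin.sum_univ_succ, lehmer_consP_zero]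
  simp only [lehmer_consP_succ]

theorem mem_desSet_succ {n : ℕ} (w : Fin n → Fin n) (i : ℕ) :
    i + 1 ∈ desSet w ↔ ∃ h : i + 1 < n, w ⟨i + 1, h⟩ < w ⟨i, by omega⟩ := by
  unfold desSet
  simp only [mem_filter, mem_Ico, Nat.add_sub_cancel]
  constructor
  · rintro ⟨_, h⟩; exact h
  · rintro ⟨h, h'⟩; exact ⟨⟨by omega, h⟩, h, h'⟩

theorem desSet_subset {n : ℕ} (w : Fin n → Fin n) : desSet w ⊆ Ico 1 n := filter_subset _ _

theorem zero_notMem_desSet {n : ℕ} (w : Fin n → Fin n) : 0 ∉ desSet w := fun h => by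
  simpa using desSet_subset w h

theorem one_mem_desSet_consP {n : ℕ} (p : Fin (n + 2)) (σ : Equiv.Perm (Fin (n + 1))) :
    1 ∈ desSet (fun i => consP p σ i) ↔ (σ 0 : ℕ) < p := by
  refine (mem_desSet_succ (fun i => consP p σ i) 0).trans ?_
  have e1 : (⟨1, by omega⟩ : Fin (n + 2)) = Fin.succ 0 := rfl
  have e2 : (⟨0, by omega⟩ : Fin (n + 2)) = 0 := rfl
  simp only [zero_add, e1, e2, consP_succ, consP_zero, Fin.succAbove_lt_iff_castSucc_lt]
  simp [Fin.lt_def]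

theorem succ_mem_desSet_consP {n : ℕ} (p : Fin (n + 1)) (σ : Equiv.Perm (Fin n)) (i : ℕ) :
    i + 2 ∈ desSet (fun i => consP p σ i) ↔ i + 1 ∈ desSet (fun i => σ i) := by
  rw [mem_desSet_succ, mem_desSet_succ]
  constructor
  · rintro ⟨h, h'⟩
    refine ⟨by omega, ?_⟩
    have e1 : (⟨i + 1 + 1, h⟩ : Fin (n + 1)) = Fin.succ ⟨i + 1, by omega⟩ := rfl
    have e2 : (⟨i + 1, by omega⟩ : Fin (n + 1)) = Fin.succ ⟨i, by omega⟩ := rfl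
    rw [e1, e2, consP_succ, consP_succ, Fin.succAbove_lt_succAbove_iff] at h'
    exact h'
  · rintro ⟨h, h'⟩
    refine ⟨by omega, ?_⟩
    have e1 : (⟨i + 1 + 1, by omega⟩ : Fin (n + 1)) = Fin.succ ⟨i + 1, by omega⟩ := rfl
    have e2 : (⟨i + 1, by omega⟩ : Fin (n + 1)) = Fin.succ ⟨i, by omega⟩ := rfl
    rw [e1, e2, consP_succ, consP_succ, Fin.succAbove_lt_succAbove_iff]
    exact h'

theorem desSet_consP_inv {n : ℕ} (p : Fin (n + 1)) (σ : Equiv.Perm (Fin n)) :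
    desSet (fun i => (consP p σ)⁻¹ i) = insD p (desSet (fun i => σ⁻¹ i)) := by
  have hlo : ∀ (i : ℕ) (h : i < n + 1) (hp : i < p),
      (consP p σ)⁻¹ ⟨i, h⟩ = (σ⁻¹ ⟨i, by omega⟩).succ := by
    intro i h hp
    rw [← consP_inv_succAbove p, Fin.succAbove_of_castSucc_lt _ _ (by simpa [Fin.lt_def] using hp)]
    rfl
  have hhi : ∀ (i : ℕ) (h : i + 1 < n + 1) (hp : p < i + 1),
      (consP p σ)⁻¹ ⟨i + 1, h⟩ = (σ⁻¹ ⟨i, by omega⟩).succ := by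
    intro i h hp
    rw [← consP_inv_succAbove p, Fin.succAbove_of_le_castSucc _ _ (by simp [Fin.le_def]; omega)]
    rfl
  have heq : ∀ (i : ℕ) (h : i < n + 1) (hp : i = p), (consP p σ)⁻¹ ⟨i, h⟩ = 0 := by
    intro i h hp
    have : (⟨i, h⟩ : Fin (n + 1)) = p := Fin.ext hp
    rw [this, consP_inv_self]
  ext i
  rcases i with _ | i
  · simp [zero_notMem_desSet, zero_notMem_insD]
  rw [mem_desSet_succ]
  have hR : i + 1 ∈ insD p (desSet (fun i => σ⁻¹ i)) ↔
      (i + 1 < p ∧ i + 1 ∈ desSet (fun i => σ⁻¹ i)) ∨ i + 1 = p ∨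
        (p < i ∧ i ∈ desSet (fun i => σ⁻¹ i)) := by
    simp only [insD, mem_union, mem_filter, mem_image]
    by_cases hp : (p : ℕ) = 0
    · simp [hp]; tauto
    · simp [hp]; tauto
  rw [hR]
  have hpn := p.2
  rcases lt_trichotomy (i + 1) (p : ℕ) with h | h | h
  · have : ¬ (p : ℕ) < i := by omega
    have h3 : i + 1 ≠ p := by omega
    simp only [h, this, h3, true_and, false_and, or_false]
    rw [mem_desSet_succ]
    constructor
    · rintro ⟨h1, h2⟩
      rw [hlo _ _ h, hlo _ _ (by omega)] at h2
      exact ⟨by omega, by simpa using h2⟩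
    · rintro ⟨h1, h2⟩
      refine ⟨by omega, ?_⟩
      rw [hlo _ _ h, hlo _ _ (by omega)]
      simpa using h2
  · simp only [h, true_or, or_true, iff_true]
    refine ⟨by omega, ?_⟩
    rw [heq _ _ rfl, hlo i _ (by omega)]
    simp
  · have h1 : ¬ (i + 1 < p) := by omega
    have h2 : i + 1 ≠ p := by omega
    simp only [h1, h2, false_and, false_or]
    rcases Nat.eq_or_lt_of_le (Nat.lt_succ_iff.1 h) with h3 | h3
    · simp only [h3, lt_irrefl, false_and, iff_false]
      rintro ⟨_, h5⟩
      rw [heq i _ h3.symm] at h5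
      simp at h5
    · simp only [h3, true_and]
      obtain ⟨k, rfl⟩ : ∃ k, i = k + 1 := ⟨i - 1, by omega⟩
      rw [mem_desSet_succ]
      constructor
      · rintro ⟨h4, h5⟩
        rw [hhi _ _ h, hhi _ _ h3] at h5
        exact ⟨by omega, by simpa using h5⟩
      · rintro ⟨h4, h5⟩
        refine ⟨by omega, ?_⟩
        rw [hhi _ _ h, hhi _ _ h3]
        simpa using h5

theorem desSet_consP_eq_iff {n : ℕ} (p : Fin (n + 2)) (σ : Equiv.Perm (Fin (n + 1))) (J : Finset ℕ)
    (hJ : J ⊆ Ico 1 (n + 2)) :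
    desSet (fun i => consP p σ i) = J ↔
      desSet (fun i => σ i) = (Ico 1 (n + 1)).filter (fun i => i + 1 ∈ J) ∧
        (1 ∈ J ↔ (σ 0 : ℕ) < p) := by
  constructor
  · rintro rfl
    refine ⟨?_, one_mem_desSet_consP p σ⟩
    ext i
    rcases i with _ | i
    · simp [zero_notMem_desSet]
    · rw [mem_filter, succ_mem_desSet_consP]
      exact ⟨fun h => ⟨desSet_subset _ h, h⟩, fun h => h.2⟩
  · rintro ⟨h1, h2⟩
    ext i
    rcases i with _ | _ | i
    · have : 0 ∉ J := fun h => by simpa using hJ h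
      simp [zero_notMem_desSet, this]
    · simp only [zero_add]
      rw [one_mem_desSet_consP, h2]
    · rw [succ_mem_desSet_consP, h1, mem_filter]
      exact ⟨fun h => h.2, fun h => ⟨by have := hJ h; simp at this ⊢; omega, h⟩⟩

theorem sum_perm_succ {n : ℕ} (J : Finset ℕ) (hJ : J ⊆ Ico 1 (n + 2))
    (F : Equiv.Perm (Fin (n + 2)) → PP) (H : Equiv.Perm (Fin (n + 1)) → ℕ → PP)
    (hF : ∀ p σ, F (consP p σ) = H σ p) :
    ∑ σ ∈ univ.filter (fun σ : Equiv.Perm (Fin (n + 2)) => desSet (fun i => σ i) = J), F σ =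
      ∑ σ ∈ univ.filter (fun σ : Equiv.Perm (Fin (n + 1)) => desSet (fun i => σ i) =
          (Ico 1 (n + 1)).filter (fun i => i + 1 ∈ J)),
        if 1 ∈ J then ∑ p ∈ range (n + 1 + 1), H σ p - ∑ p ∈ range (σ 0 + 1), H σ p
          else ∑ p ∈ range (σ 0 + 1), H σ p := by
  rw [sum_filter, ← (consP_bij (n + 1)).sum_comp, Fintype.sum_prod_type, sum_filter]
  apply sum_congr rfl
  intro σ _
  simp only [desSet_consP_eq_iff _ _ _ hJ, hF]
  by_cases h : desSet (fun i => σ i) = (Ico 1 (n + 1)).filter (fun i => i + 1 ∈ J)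
  · simp only [h, true_and, if_true]
    rw [Fin.sum_univ_eq_sum_range (fun p => if (1 ∈ J ↔ (σ 0 : ℕ) < p) then H σ p else 0) (n + 2)]
    have hs : range (σ 0 + 1) = (range (n + 2)).filter (fun p => ¬ (σ 0 : ℕ) < p) := by
      ext x
      have := (σ 0).2
      simp only [mem_range, mem_filter]; omega
    have key := sum_filter_add_sum_filter_not (range (n + 2)) (fun p => (σ 0 : ℕ) < p) (H σ)
    by_cases h1 : 1 ∈ J
    · simp only [h1, true_iff, if_true]
      rw [← sum_filter, hs, ← key]; ring
    · simp only [h1, false_iff, if_false]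
      rw [← sum_filter, hs]
  · simp [h]

theorem main_aux (n : ℕ) : ∀ (J : Finset ℕ) (_ : J ⊆ Ico 1 (n + 1)) (a : ℕ) (W : ℕ → PP),
    ∑ σ ∈ univ.filter (fun σ : Equiv.Perm (Fin (n + 1)) => desSet (fun i => σ i) = J),
        GG W a (σ 0) (desSet (fun i => σ⁻¹ i)) =
      ∑ σ ∈ univ.filter (fun σ : Equiv.Perm (Fin (n + 1)) => desSet (fun i => σ i) = J),
        qP ^ invStat (fun i => σ i) * KK W a (σ 0) (stcStat (fun i => σ i)) := by
  induction n with
  | zero =>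
    intro J _ a W
    apply sum_congr rfl
    intro σ _
    have h1 : σ = consP 0 1 := Equiv.ext fun i => Subsingleton.elim (α := Fin 1) _ _
    have hd : desSet (fun i => (consP (0 : Fin 1) 1)⁻¹ i) = ∅ := by
      rw [← subset_empty]; exact desSet_subset _
    have hs : stcStat (fun i => (1 : Equiv.Perm (Fin 0)) i) = 0 :=
      Nat.le_zero.1 (hasStaircase_le ((hasStaircase_iff _ _).2 le_rfl))
    rw [h1, hd, stc_consP, inv_consP, hs, GG_eq _ _ _ _ (by simp)]
    simp [KK_zero, invStat]
  | succ n ih =>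
    intro J hJ a W
    have hJ' : (Ico 1 (n + 1)).filter (fun i => i + 1 ∈ J) ⊆ Ico 1 (n + 1) := filter_subset _ _
    rw [sum_perm_succ J hJ (fun σ => GG W a (σ 0) (desSet (fun i => σ⁻¹ i)))
        (fun σ p => GG W a p (insD p (desSet (fun i => σ⁻¹ i))))
        (fun p σ => by simp only [desSet_consP_inv, consP_zero]),
      sum_perm_succ J hJ (fun σ => qP ^ invStat (fun i => σ i) * KK W a (σ 0) (stcStat (fun i => σ i)))
        (fun σ p => qP ^ invStat (fun i => σ i) * (qP ^ p * KK W a p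
          (if stcStat (fun i => σ i) < p then stcStat (fun i => σ i) + 1 else stcStat (fun i => σ i))))
        (fun p σ => by simp only [stc_consP, inv_consP, consP_zero]; ring)]
    have eG : ∀ v D, ∑ p ∈ range (v + 1), GG W a p (insD p D) = GG W (a + 1) v D := fun _ _ => rfl
    have eK : ∀ v r, ∑ c ∈ range (v + 1), qP ^ c * KK W a c (if r < c then r + 1 else r) =
      KK W (a + 1) v r := fun _ _ => rfl
    simp only [← mul_sum, eG, eK]
    by_cases h1 : 1 ∈ J
    · simp only [h1, if_true, sum_sub_distrib]
      rw [ih _ hJ' (a + 1) W]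
      congr 1
      have := ih _ hJ' 0 (fun r => KK W (a + 1) (n + 1) r)
      simp only [KK] at this ⊢
      rw [← this]
      apply sum_congr rfl
      intro σ _
      rw [GG_top _ _ _ _ ((desSet_subset _).trans (Ico_subset_Ico_right (by omega)))]
      rfl
    · simp only [h1, if_false]
      exact ih _ hJ' (a + 1) W

/-- Foata–Han: on each descent class `{w ∈ S_n : Des w = J}`, the pair
`(des ∘ inv, maj ∘ inv)` is equidistributed with `(stc, inv)`. -/
theorem des_maj_inverse_equidistributed_stc_inv_on_descent_class
    (n : ℕ) (J : Finset ℕ) (hJ : J ⊆ Finset.Ico 1 n) :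
    ∑ σ ∈ Finset.univ.filter (fun σ : Equiv.Perm (Fin n) => desSet (fun i => σ i) = J),
        xP ^ desStat (fun i => σ⁻¹ i) * qP ^ majStat (fun i => σ⁻¹ i) =
      ∑ σ ∈ Finset.univ.filter (fun σ : Equiv.Perm (Fin n) => desSet (fun i => σ i) = J),
        xP ^ stcStat (fun i => σ i) * qP ^ invStat (fun i => σ i) := by
  rcases n with _ | n
  · apply sum_congr rfl
    intro σ _
    have hd : desSet (fun i => σ⁻¹ i) = ∅ := by
      rw [← subset_empty]; exact desSet_subset _
    have hs : stcStat (fun i => σ i) = 0 :=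
      Nat.le_zero.1 (hasStaircase_le ((hasStaircase_iff _ _).2 le_rfl))
    simp only [desStat, majStat, hd, hs]
    simp [invStat]
  · have := main_aux n J hJ 0 (fun r => xP ^ r)
    simp only [GG, KK] at this
    simp only [desStat, majStat]
    simp only [mul_comm (xP ^ _)]
    exact this
end

section
/- Let rho = (rho_1,...,rho_m) be a composition of N, r_i = rho_1 + ... + rho_i, and R = {r_1,...,r_{m-1}}. Then the joint distribution of (des, maj) over multiset permutations of {1^{rho_1},...,m^{rho_m}} equals the joint distribution of (stc, inv) over the quotient S_N^R = {w in S_N : Des(w) is contained in R}. -/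
open Finset

/-- Permutations of the multiset `{1^{ρ_1}, …, m^{ρ_m}}`, as words of length `N`
in the alphabet `Fin m` with `ρ_j` occurrences of the letter `j`. -/
def multisetPerms (m N : ℕ) (rho : Fin m → ℕ) : Finset (Fin N → Fin m) :=
  Finset.univ.filter fun w => ∀ j : Fin m, (Finset.univ.filter fun i => w i = j).card = rho j

/-- The set `R = {r_1, …, r_{m-1}}` of partial sums `r_i = ρ_1 + ⋯ + ρ_i` of a composition. -/
def partialSums (m : ℕ) (rho : Fin m → ℕ) : Finset ℕ :=
  (Finset.range (m - 1)).image fun k =>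
    ∑ j ∈ Finset.univ.filter (fun j : Fin m => (j : ℕ) ≤ k), rho j

/-- The quotient `S_N^R = {σ ∈ S_N : Des σ ⊆ R}`. -/
def quotientByR (N : ℕ) (R : Finset ℕ) : Finset (Equiv.Perm (Fin N)) :=
  Finset.univ.filter fun σ => desSet (fun i => σ i) ⊆ R

/-- Standardisation of a multiset word: position `i` receives the rank of
the pair `(w i, i)` in lexicographic order; equivalently, the `ρ_1` letters `1` are
replaced, left to right, by `1, …, ρ_1`, the `ρ_2` letters `2` by `ρ_1 + 1, …, ρ_1 + ρ_2`,
and so on.  It is the inverse of the permutation sorting the (injective) key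
`i ↦ (w i, i)`. -/
def stdPerm {m N : ℕ} (w : Fin N → Fin m) : Equiv.Perm (Fin N) :=
  (Tuple.sort fun i => toLex (w i, i))⁻¹


namespace DM

/-- descents of the reversed list -/
def desL : List ℕ → ℕ
  | [] => 0
  | [_] => 0
  | a :: b :: w => desL (b :: w) + if a < b then 1 else 0

/-- major index of the reversed list -/
def majL : List ℕ → ℕ
  | [] => 0
  | [_] => 0
  | a :: b :: w => majL (b :: w) + if a < b then w.length + 1 else 0

/-- shuffles of `w` with `p` zeros -/
def sh : List ℕ → ℕ → List (List ℕ)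
  | [], p => [List.replicate p 0]
  | a :: w, 0 => [a :: w]
  | a :: w, p + 1 => (sh (a :: w) p).map (List.cons 0) ++ (sh w (p + 1)).map (List.cons a)
termination_by w p => w.length + p

/-- weakly increasing extensions -/
def ext : ℕ → ℕ → List ℕ → List (List ℕ)
  | _, 0, c => [c]
  | 0, p + 1, c => ext 0 p (0 :: c)
  | M + 1, p + 1, c => ext M (p + 1) c ++ ext (M + 1) p ((M + 1) :: c)
termination_by M p => M + p

def stcL : List ℕ → ℕ
  | [] => 0
  | a :: c => stcL c + if stcL c < a then 1 else 0

def WW : List ℕ → List (List ℕ)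
  | [] => [[]]
  | p :: ρ => (WW ρ).flatMap fun w => sh (w.map Nat.succ) p

def CC : List ℕ → List (List ℕ)
  | [] => [[]]
  | p :: ρ => (CC ρ).flatMap (ext ρ.sum p)

section gen
variable {A : Type*} [CommSemiring A] (q : A)

def G (φ : ℕ → A) : ℕ → ℕ → ℕ → A
  | _, 0, d => φ d
  | 0, p + 1, d => G φ 0 p d
  | M + 1, p + 1, d => G φ M (p + 1) d + q ^ (M + 1) * G φ (M + 1) p (d + if d < M + 1 then 1 else 0)
termination_by M p => M + p

theorem G_p0 (φ : ℕ → A) (M d : ℕ) : G q φ M 0 d = φ d := by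
  cases M <;> rw [G]

theorem G_M0 (φ : ℕ → A) (p d : ℕ) : G q φ 0 p d = φ d := by
  induction p with
  | zero => rw [G]
  | succ p ih => rw [G, ih]

theorem G_ss (φ : ℕ → A) (M p d : ℕ) : G q φ (M + 1) (p + 1) d = G q φ M (p + 1) d +
    q ^ (M + 1) * G q φ (M + 1) p (d + if d < M + 1 then 1 else 0) := by
  rw [G]

theorem G_shift (s : ℕ) : ∀ (φ : ℕ → A) (M p d : ℕ), M + p = s →
    G q φ (M + 1) (p + 1) (d + 1) =
    G q φ (M + 1) p (d + 1) + q ^ (p + 1) * G q (fun i => φ (i + 1)) M (p + 1) d := by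
  induction s using Nat.strong_induction_on with
  | _ s ih =>
    intro φ M p d hs
    rcases M with _ | M
    · rcases p with _ | p
      · simp [G, G_M0]
      · have h := ih p (by omega) φ 0 p d (by omega)
        have h3 := G_ss q φ 0 p (d + 1)
        have h4 := G_ss q φ 0 (p + 1) (d + 1)
        simp only [G_M0, Nat.zero_add, show ¬ (d + 1 < 1) by omega, if_false, Nat.add_zero] at h h3 h4 ⊢
        rw [h4]
        conv_lhs => rw [h]
        conv_rhs => rw [h3]
        ring
    · have h1 := ih (M + p) (by omega) φ M p d rfl
      rw [G, h1]
      rw [G_ss q _ M p d]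
      rcases p with _ | p
      · simp only [G_p0]
        have e : (d + 1 + if d + 1 < M + 1 + 1 then 1 else 0)
          = (d + if d < M + 1 then 1 else 0) + 1 := by split_ifs <;> omega
        rw [e]; ring
      · have e : (d + 1 + if d + 1 < M + 1 + 1 then 1 else 0)
          = (d + if d < M + 1 then 1 else 0) + 1 := by split_ifs <;> omega
        rw [e]
        have h2 := ih (M + 1 + p) (by omega) φ (M + 1) p (d + if d < M + 1 then 1 else 0) rfl
        rw [h2]
        rw [G_ss q φ (M + 1) p (d + 1)]
        rw [e]; ring

def ev (φ : ℕ → A) (u : List ℕ) : A := φ (desL u) * q ^ majL u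

theorem sh_length (w : List ℕ) : ∀ p u, u ∈ sh w p → u.length = w.length + p := by
  induction w with
  | nil => intro p u h; simp [sh] at h; simp [h]
  | cons a w ihw =>
    intro p
    induction p with
    | zero => intro u h; simp [sh] at h; simp [h]
    | succ p ih =>
      intro u h
      rw [sh] at h
      simp only [List.mem_append, List.mem_map] at h
      rcases h with ⟨v, hv, rfl⟩ | ⟨v, hv, rfl⟩
      · have := ih v hv; simp at this ⊢; omega
      · have := ihw _ v hv; simp at this ⊢; omega

theorem des_rep (p : ℕ) : desL (List.replicate p 0) = 0 ∧ majL (List.replicate p 0) = 0 := by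
  induction p with
  | zero => simp [desL, majL]
  | succ p ih =>
    rcases p with _ | p
    · simp [desL, majL]
    · simp only [List.replicate_succ, desL, majL] at ih ⊢; simp [ih]

theorem des_rep' (a p : ℕ) : desL (a :: List.replicate p 0) = 0 ∧
    majL (a :: List.replicate p 0) = 0 := by
  rcases p with _ | p
  · simp [desL, majL]
  · have := des_rep (p + 1)
    simp only [List.replicate_succ, desL, majL] at this ⊢; simp [this]

theorem des_lt (a : ℕ) (w : List ℕ) : desL (a :: w) ≤ w.length := by
  induction w generalizing a with
  | nil => simp [desL]
  | cons b w ih => have := ih b; simp only [desL, List.length_cons]; split_ifs <;> omega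

theorem P0_of_P1 (a : ℕ) (w : List ℕ) (ha : 0 < a)
    (P1 : ∀ (φ : ℕ → A) p, ((sh w p).map fun u => ev q φ (a :: u)).sum =
      q ^ majL (a :: w) * G q φ w.length p (desL (a :: w))) (φ : ℕ → A) (p : ℕ) :
    ((sh (a :: w) p).map fun u => ev q φ (0 :: u)).sum =
      q ^ (majL (a :: w) + w.length + 1) * G q φ (w.length + 1) p (desL (a :: w) + 1) := by
  induction p with
  | zero => 
    simp [sh, ev, G_p0, desL, majL, ha]
    ring
  | succ p ih =>
    rw [sh, List.map_append, List.sum_append, List.map_map, List.map_map, G_shift q _ φ _ _ _ rfl,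
      mul_add, ← ih]
    refine congrArg₂ (· + ·) ?_ ?_
    · congr 1
    · have := P1 (fun i => φ (i+1)) (p+1)
      have e : (List.map ((fun u => ev q φ (0 :: u)) ∘ List.cons a) (sh w (p + 1))) = 
          (List.map (fun u => q ^ (w.length + p + 2) * ev q (fun i => φ (i+1)) (a :: u)) (sh w (p + 1))) := by
        apply List.map_congr_left
        intro u hu
        have hl := sh_length w _ u hu
        simp [ev, desL, majL, ha, hl]
        ring
      rw [e, List.sum_map_mul_left, this]
      ring

theorem P1 (w : List ℕ) (hw : ∀ a ∈ w, 0 < a) : ∀ (a : ℕ) (φ : ℕ → A) p,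
    ((sh w p).map fun u => ev q φ (a :: u)).sum =
      q ^ majL (a :: w) * G q φ w.length p (desL (a :: w)) := by
  induction w with
  | nil => 
    intro a φ p
    have := des_rep' a p
    simp [sh, ev, this, G_M0, desL, majL]
  | cons b w ih =>
    intro a φ p
    have hb : 0 < b := hw b (by simp)
    have ih' := ih (fun a h => hw a (by simp [h]))
    rcases p with _ | p
    · simp [sh, ev, G_p0]; ring
    · have h0 := P0_of_P1 q b w hb (ih' b) φ p
      rw [sh, List.map_append, List.sum_append, List.map_map, List.map_map]
      have e1 : (List.map ((fun u => ev q φ (a :: u)) ∘ List.cons 0) (sh (b :: w) p)) = 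
          (List.map (fun u => ev q φ (0 :: u)) (sh (b :: w) p)) := by
        apply List.map_congr_left
        intro u hu
        simp [ev, desL, majL]
      rw [e1, h0]
      have hd := des_lt b w
      by_cases hab : a < b
      · have e2 : (List.map ((fun u => ev q φ (a :: u)) ∘ List.cons b) (sh w (p + 1))) = 
          (List.map (fun u => q ^ (w.length + p + 2) * ev q (fun i => φ (i+1)) (b :: u)) (sh w (p + 1))) := by
          apply List.map_congr_left
          intro u hu
          have hl := sh_length w _ u hu
          simp [ev, desL, majL, hab, hl]
          ring
        rw [e2, List.sum_map_mul_left, ih']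
        simp only [desL, majL, hab, if_true, List.length_cons]
        rw [G_shift q _ φ _ _ _ rfl]
        ring
      · have e2 : (List.map ((fun u => ev q φ (a :: u)) ∘ List.cons b) (sh w (p + 1))) = 
          (List.map (fun u => ev q φ (b :: u)) (sh w (p + 1))) := by
          apply List.map_congr_left
          intro u hu
          simp [ev, desL, majL, hab]
        rw [e2, ih']
        simp only [desL, majL, hab, if_false, List.length_cons]
        conv_rhs => rw [G]
        simp only [show desL (b :: w) < w.length + 1 by omega, if_true, Nat.add_zero]
        ring

theorem PF (w : List ℕ) (hw : ∀ a ∈ w, 0 < a) (φ : ℕ → A) (p : ℕ) :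
    ((sh w p).map fun u => ev q φ u).sum =
      q ^ majL w * G q φ w.length p (desL w) := by
  rcases w with _ | ⟨b, w⟩
  · have := des_rep p
    simp [sh, ev, this, G_M0, desL, majL]
  rcases p with _ | p
  · simp [sh, ev, G_p0]; ring
  have hb : 0 < b := hw b (by simp)
  have h1 := P1 q w (fun a h => hw a (by simp [h]))
  have h0 := P0_of_P1 q b w hb (h1 b) φ p
  rw [sh, List.map_append, List.sum_append, List.map_map, List.map_map]
  have e1 : (List.map ((fun u => ev q φ u) ∘ List.cons 0) (sh (b :: w) p)) = 
      (List.map (fun u => ev q φ (0 :: u)) (sh (b :: w) p)) := rfl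
  have e2 : (List.map ((fun u => ev q φ u) ∘ List.cons b) (sh w (p+1))) = 
      (List.map (fun u => ev q φ (b :: u)) (sh w (p+1))) := rfl
  rw [e1, e2, h0, h1]
  have hd := des_lt b w
  simp only [List.length_cons]
  conv_rhs => rw [G]
  simp only [show desL (b :: w) < w.length + 1 by omega, if_true]
  ring

theorem ext_sum (φ : ℕ → A) (s : ℕ) : ∀ M p c, M + p = s →
    ((ext M p c).map fun l => φ (stcL l) * q ^ l.sum).sum = q ^ c.sum * G q φ M p (stcL c) := by
  induction s using Nat.strong_induction_on with
  | _ s ih =>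
    intro M p c hs
    rcases p with _ | p
    · rw [ext, G_p0]; simp; ring
    rcases M with _ | M
    · rw [ext, G, ih p (by omega) 0 p _ (by omega)]
      simp [stcL]
    · rw [ext, G, List.map_append, List.sum_append, ih _ (by omega) M (p+1) c rfl,
        ih _ (by omega) (M+1) p _ rfl]
      simp only [stcL, List.sum_cons]
      ring

theorem map_succ (w : List ℕ) : desL (w.map Nat.succ) = desL w ∧ majL (w.map Nat.succ) = majL w := by
  induction w with
  | nil => simp
  | cons a w ih =>
    rcases w with _ | ⟨b, w⟩
    · simp [desL, majL]
    · simp only [List.map_cons, desL, majL] at ih ⊢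
      simp [ih]

theorem WW_length (ρ : List ℕ) : ∀ u ∈ WW ρ, u.length = ρ.sum := by
  induction ρ with
  | nil => simp [WW]
  | cons p ρ ih =>
    intro u hu
    simp only [WW, List.mem_flatMap] at hu
    obtain ⟨w, hw, h⟩ := hu
    have := sh_length _ _ _ h
    simp [ih w hw] at this ⊢; omega

theorem main_list (ρ : List ℕ) : ∀ φ : ℕ → A, ((WW ρ).map fun u => φ (desL u) * q ^ majL u).sum =
    ((CC ρ).map fun l => φ (stcL l) * q ^ l.sum).sum := by
  induction ρ with
  | nil => intro φ; simp [WW, CC, desL, majL, stcL]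
  | cons p ρ ih =>
    intro φ
    have := ih (fun d => G q φ ρ.sum p d)
    simp only [WW, CC, List.flatMap_def, List.map_flatten, List.sum_flatten, List.map_map]
    have e1 : (List.map (List.sum ∘ fun a => List.map (fun u => φ (desL u) * q ^ majL u) (sh (List.map Nat.succ a) p)) (WW ρ)) = List.map (fun u => G q φ ρ.sum p (desL u) * q ^ majL u) (WW ρ) := by
      apply List.map_congr_left
      intro w hw
      have h := PF q (w.map Nat.succ) (by simp) φ p
      simp only [map_succ, List.length_map, WW_length _ _ hw] at h
      rw [mul_comm, ← h]; rfl
    have e2 : (List.map (List.sum ∘ fun a => List.map (fun l => φ (stcL l) * q ^ l.sum) (ext ρ.sum p a)) (CC ρ)) = List.map (fun l => G q φ ρ.sum p (stcL l) * q ^ l.sum) (CC ρ) := by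
      apply List.map_congr_left
      intro w hw
      have h := ext_sum q φ _ ρ.sum p w rfl
      rw [mul_comm, ← h]; rfl
    exact (congrArg List.sum e1).trans (this.trans (congrArg List.sum e2).symm)
end gen

theorem mem_sh (w : List ℕ) (hw : ∀ a ∈ w, 0 < a) : ∀ p u, u ∈ sh w p ↔
    u.filter (fun a => decide (0 < a)) = w ∧ u.count 0 = p := by
  induction w with
  | nil =>
    intro p u
    simp only [sh, List.mem_singleton, List.filter_eq_nil_iff, decide_eq_true_eq, not_lt, Nat.le_zero]
    constructor
    · rintro rfl; simp
    · rintro ⟨h1, h2⟩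
      rw [List.eq_replicate_iff]
      refine ⟨?_, h1⟩
      rw [← h2, eq_comm, List.count_eq_length]
      intro b hb; exact (h1 b hb).symm
  | cons a w ihw =>
    have ha : 0 < a := hw a (by simp)
    have hw' : ∀ a ∈ w, 0 < a := fun a h => hw a (by simp [h])
    intro p
    induction p with
    | zero =>
      intro u
      simp only [sh, List.mem_singleton]
      constructor
      · rintro rfl
        constructor
        · rw [List.filter_eq_self]; simpa using hw
        · rw [List.count_eq_zero]; intro h; exact absurd (hw 0 h) (by simp)
      · rintro ⟨h1, h2⟩
        rw [← h1, eq_comm, List.filter_eq_self]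
        intro x hx
        rw [List.count_eq_zero] at h2
        simp only [decide_eq_true_eq]
        rcases Nat.eq_zero_or_pos x with h | h
        · subst h; exact absurd hx h2
        · exact h
    | succ p ih =>
      intro u
      rw [sh]
      simp only [List.mem_append, List.mem_map, ih, ihw hw']
      constructor
      · rintro (⟨v, ⟨h1, h2⟩, rfl⟩ | ⟨v, ⟨h1, h2⟩, rfl⟩)
        · simp [h1, h2]
        · simp [h1, h2, ha, ha.ne']
      · rintro ⟨h1, h2⟩
        rcases u with _ | ⟨b, v⟩
        · simp at h1
        rcases Nat.eq_zero_or_pos b with h | h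
        · subst h
          left
          refine ⟨v, ⟨by simpa using h1, by simpa using h2⟩, rfl⟩
        · right
          simp [h, h.ne'] at h1 h2
          refine ⟨v, ⟨h1.2, h2⟩, by rw [h1.1]⟩

theorem nodup_sh (w : List ℕ) (hw : ∀ a ∈ w, 0 < a) : ∀ p, (sh w p).Nodup := by
  induction w with
  | nil => intro p; simp [sh]
  | cons a w ihw =>
    have ha : 0 < a := hw a (by simp)
    have hw' : ∀ a ∈ w, 0 < a := fun a h => hw a (by simp [h])
    intro p
    induction p with
    | zero => simp [sh]
    | succ p ih =>
      rw [sh, List.nodup_append]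
      refine ⟨ih.map List.cons_injective, (ihw hw' _).map List.cons_injective, ?_⟩
      intro x hx y hy
      simp only [List.mem_map] at hx hy
      obtain ⟨_, _, rfl⟩ := hx
      obtain ⟨_, _, rfl⟩ := hy
      intro h
      simp at h; omega

theorem mem_WW (ρ : List ℕ) : ∀ u, u ∈ WW ρ ↔ ∀ j, u.count j = ρ.getD j 0 := by
  induction ρ with
  | nil =>
    intro u
    simp only [WW, List.mem_singleton, List.getD_nil, List.count_eq_zero]
    exact ⟨by rintro rfl; simp, fun h => List.eq_nil_iff_forall_not_mem.2 h⟩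
  | cons p ρ ih =>
    intro u
    simp only [WW, List.mem_flatMap, ih]
    have hc : ∀ j, (u.filter (fun a => decide (0 < a))).count (j+1) = u.count (j+1) := by
      intro j
      rw [List.count_filter]; simp
    have hs : ∀ (w : List ℕ) j, (w.map Nat.succ).count (j+1) = w.count j := fun w j =>
      List.count_map_of_injective w Nat.succ Nat.succ_injective j
    constructor
    · rintro ⟨w, hw, h⟩
      rw [mem_sh _ (by simp)] at h
      intro j
      rcases j with _ | j
      · simp [h.2]
      · rw [← hc, h.1, hs, hw]; simp
    · intro h
      have e : ((u.filter (fun a => decide (0 < a))).map Nat.pred).map Nat.succ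
          = u.filter (fun a => decide (0 < a)) := by
        rw [List.map_map]
        conv_rhs => rw [← List.map_id (u.filter (fun a => decide (0 < a)))]
        apply List.map_congr_left
        intro a ha
        simp only [List.mem_filter, decide_eq_true_eq] at ha
        simp only [Function.comp, id]
        exact Nat.succ_pred_eq_of_pos ha.2
      refine ⟨(u.filter (fun a => decide (0 < a))).map Nat.pred, ?_, ?_⟩
      · intro j
        rw [← hs, e, hc, h]; simp
      · rw [mem_sh _ (by intro a ha; rw [List.mem_map] at ha; obtain ⟨_, _, rfl⟩ := ha; simp)]
        refine ⟨e.symm, by simpa using h 0⟩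

theorem nodup_WW (ρ : List ℕ) : (WW ρ).Nodup := by
  induction ρ with
  | nil => simp [WW]
  | cons p ρ ih =>
    rw [WW, List.nodup_flatMap]
    refine ⟨fun w _ => nodup_sh _ (by simp) _, ?_⟩
    refine ih.imp ?_
    intro a b hab
    simp only [Function.onFun]
    intro u h1 h2
    rw [mem_sh _ (by simp)] at h1 h2
    exact hab (List.map_injective_iff.2 Nat.succ_injective (h1.1.symm.trans h2.1))

theorem mem_ext (s : ℕ) : ∀ M p c, M + p = s → ∀ l, l ∈ ext M p c ↔ ∃ b : List ℕ,
    b.length = p ∧ b.Pairwise (· ≤ ·) ∧ (∀ x ∈ b, x ≤ M) ∧ l = b ++ c := by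
  induction s using Nat.strong_induction_on with
  | _ s ih =>
    intro M p c hs l
    rcases p with _ | p
    · rw [ext]
      simp [List.length_eq_zero_iff]
    rcases M with _ | M
    · rw [ext, ih p (by omega) 0 p _ (by omega)]
      constructor
      · rintro ⟨b, h1, h2, h3, rfl⟩
        refine ⟨b ++ [0], by simp [h1], ?_, ?_, by simp⟩
        · rw [List.pairwise_append]
          refine ⟨h2, by simp, ?_⟩
          simpa using h3
        · intro x hx
          simp only [List.mem_append, List.mem_singleton] at hx
          rcases hx with hx | rfl
          · exact h3 x hx
          · simp
      · rintro ⟨b, h1, h2, h3, rfl⟩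
        rcases List.eq_nil_or_concat b with rfl | ⟨b', a, rfl⟩
        · simp at h1
        simp only [List.concat_eq_append] at *
        have ha : a = 0 := by have := h3 a (by simp); omega
        subst ha
        rw [List.pairwise_append] at h2
        refine ⟨b', by simpa using h1, h2.1, fun x hx => h3 x (by simp [hx]), by simp⟩
    · rw [ext, List.mem_append, ih _ (by omega) M (p+1) c rfl, ih _ (by omega) (M+1) p _ rfl]
      constructor
      · rintro (⟨b, h1, h2, h3, rfl⟩ | ⟨b, h1, h2, h3, rfl⟩)
        · exact ⟨b, h1, h2, fun x hx => (h3 x hx).trans (by omega), rfl⟩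
        · refine ⟨b ++ [M+1], by simp [h1], ?_, ?_, by simp⟩
          · rw [List.pairwise_append]
            refine ⟨h2, by simp, ?_⟩
            simpa using h3
          · intro x hx
            simp only [List.mem_append, List.mem_singleton] at hx
            rcases hx with hx | rfl
            · exact h3 x hx
            · simp
      · rintro ⟨b, h1, h2, h3, rfl⟩
        rcases List.eq_nil_or_concat b with rfl | ⟨b', a, rfl⟩
        · simp at h1
        simp only [List.concat_eq_append] at *
        have ha := h3 a (by simp)
        have h2' := List.pairwise_append.1 h2
        rcases Nat.lt_or_ge a (M+1) with h | h
        · left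
          refine ⟨_, h1, h2, ?_, rfl⟩
          intro x hx
          simp only [List.mem_append, List.mem_singleton] at hx
          rcases hx with hx | rfl
          · have := h2'.2.2 x hx a (by simp); omega
          · omega
        · right
          have : a = M + 1 := by omega
          subst this
          refine ⟨b', by simpa using h1, h2'.1, fun x hx => h3 x (by simp [hx]), by simp⟩

theorem nodup_ext (s : ℕ) : ∀ M p c, M + p = s → (ext M p c).Nodup := by
  induction s using Nat.strong_induction_on with
  | _ s ih =>
    intro M p c hs
    rcases p with _ | p
    · rw [ext]; simp
    rcases M with _ | M
    · rw [ext]; exact ih p (by omega) 0 p _ (by omega)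
    · rw [ext, List.nodup_append]
      refine ⟨ih _ (by omega) M (p+1) c rfl, ih _ (by omega) (M+1) p _ rfl, ?_⟩
      intro x hx y hy hxy
      subst hxy
      rw [mem_ext _ _ _ _ rfl] at hx hy
      obtain ⟨b, h1, h2, h3, rfl⟩ := hx
      obtain ⟨b', h1', h2', h3', h4⟩ := hy
      rw [show b' ++ (M+1) :: c = (b' ++ [M+1]) ++ c by simp] at h4
      have := List.append_cancel_right h4
      have := h3 (M+1) (by simp [this])
      omega

theorem nodup_CC (ρ : List ℕ) : (CC ρ).Nodup := by
  induction ρ with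
  | nil => simp [CC]
  | cons p ρ ih =>
    rw [CC, List.nodup_flatMap]
    refine ⟨fun w _ => nodup_ext _ _ _ _ rfl, ?_⟩
    refine ih.imp ?_
    intro a b hab
    simp only [Function.onFun]
    intro u h1 h2
    rw [mem_ext _ _ _ _ rfl] at h1 h2
    obtain ⟨b1, h1, -, -, rfl⟩ := h1
    obtain ⟨b2, h2, -, -, h⟩ := h2
    exact hab (List.append_inj h (by omega)).2

theorem mem_CC (ρ : List ℕ) : ∀ l, l ∈ CC ρ ↔ l.length = ρ.sum ∧
    (∀ i < ρ.sum, l.getD i 0 + i + 1 ≤ ρ.sum) ∧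
    (∀ i, i + 1 < ρ.sum → (∀ k, (ρ.take k).sum ≠ i + 1) → l.getD i 0 ≤ l.getD (i+1) 0) := by
  induction ρ with
  | nil => intro l; simp [CC, List.length_eq_zero_iff]
  | cons p ρ ih =>
    intro l
    simp only [CC, List.mem_flatMap, ih, mem_ext _ _ _ _ rfl, List.sum_cons]
    constructor
    · rintro ⟨c, ⟨c1, c2, c3⟩, b, h1, h2, h3, rfl⟩
      refine ⟨by simp [h1, c1], ?_, ?_⟩
      · intro i hi
        rcases Nat.lt_or_ge i p with h | h
        · rw [List.getD_append _ _ _ _ (by omega), List.getD_eq_getElem _ _ (by omega)]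
          have := h3 (b[i]) (List.getElem_mem _); omega
        · rw [List.getD_append_right _ _ _ _ (by omega), h1]
          have := c2 (i - p) (by omega); omega
      · intro i hi hk
        have hp : p ≠ i + 1 := by simpa using hk 1
        rcases Nat.lt_or_ge (i + 1) p with h | h
        · rw [List.getD_append _ _ _ _ (by omega), List.getD_append _ _ _ _ (by omega),
            List.getD_eq_getElem _ _ (by omega), List.getD_eq_getElem _ _ (by omega)]
          exact List.pairwise_iff_getElem.1 h2 _ _ _ _ (by omega)
        · rw [List.getD_append_right _ _ _ _ (by omega), List.getD_append_right _ _ _ _ (by omega), h1,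
            show i + 1 - p = (i - p) + 1 by omega]
          apply c3 _ (by omega)
          intro k hk'
          apply hk (k+1)
          simp; omega
    · rintro ⟨l1, l2, l3⟩
      have hsum : ∀ k, (ρ.take k).sum ≤ ρ.sum := fun k => (List.take_sublist k ρ).sum_le_sum (by simp)
      have hd : ∀ i, (l.drop p).getD i 0 = l.getD (p + i) 0 := by
        intro i; simp [List.getD_eq_getElem?_getD]
      refine ⟨l.drop p, ⟨by simp [l1], ?_, ?_⟩, l.take p, by simp [l1], ?_, ?_, by simp⟩
      · intro i hi
        rw [hd]
        have := l2 (p + i) (by omega); omega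
      · intro i hi hk
        rw [hd, hd, ← Nat.add_assoc]
        apply l3 _ (by omega)
        intro k
        rcases k with _ | k
        · simp
        · have := hk k; simp; omega
      all_goals
        have hmono : (l.take p).Pairwise (· ≤ ·) := by
          rw [← List.isChain_iff_pairwise, List.isChain_iff_getElem]
          intro i hi
          simp at hi
          have := l3 i (by omega) (by
            intro k
            rcases k with _ | k
            · simp
            · simp; omega)
          rw [List.getD_eq_getElem _ _ (by omega), List.getD_eq_getElem _ _ (by omega)] at this
          simpa using this
      · exact hmono
      · intro x hx
        obtain ⟨i, hi, rfl⟩ := List.mem_iff_getElem.1 hx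
        simp [l1] at hi
        have h1 : (l.take p)[i] ≤ (l.take p)[p-1]'(by simp [l1]; omega) := by
          rcases Nat.lt_or_ge i (p-1) with h | h
          · exact List.pairwise_iff_getElem.1 hmono _ _ _ _ h
          · simp only [show i = p - 1 by omega]; exact le_rfl
        have h2 := l2 (p-1) (by omega)
        rw [List.getD_eq_getElem _ _ (by omega)] at h2
        simp at h1 ⊢
        omega

theorem mem_desSet {α : Type*} [LinearOrder α] {n : ℕ} (w : Fin n → α) (i : ℕ) :
    i ∈ desSet w ↔ ∃ (h : i < n) (_ : 1 ≤ i), w ⟨i, h⟩ < w ⟨i - 1, by omega⟩ := by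
  simp only [desSet, Finset.mem_filter, Finset.mem_Ico]
  constructor
  · rintro ⟨⟨h1, h2⟩, h3, h4⟩; exact ⟨h3, h1, h4⟩
  · rintro ⟨h3, h1, h4⟩; exact ⟨⟨h1, h3⟩, h3, h4⟩

theorem desSet_snoc {n : ℕ} (v : Fin (n + 2) → ℕ) :
    desSet v = if v (Fin.last (n + 1)) < v (Fin.last n).castSucc then
      insert (n + 1) (desSet fun i : Fin (n + 1) => v i.castSucc)
      else desSet fun i : Fin (n + 1) => v i.castSucc := by
  ext i
  by_cases hi : i = n + 1
  · subst hi
    have h1 : n + 1 ∉ desSet fun i : Fin (n + 1) => v i.castSucc := by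
      rw [mem_desSet]; rintro ⟨h, _⟩; omega
    have h2 : n + 1 ∈ desSet v ↔ v (Fin.last (n + 1)) < v (Fin.last n).castSucc := by
      rw [mem_desSet]
      constructor
      · rintro ⟨_, _, h⟩; exact h
      · intro h; exact ⟨by omega, by omega, h⟩
    rw [h2]
    split_ifs with h
    · simp [h]
    · simp only [h1, h]
  · have h2 : i ∈ desSet v ↔ i ∈ desSet fun i : Fin (n + 1) => v i.castSucc := by
      rw [mem_desSet, mem_desSet]
      constructor
      · rintro ⟨_, h', h⟩; exact ⟨by omega, h', h⟩
      · rintro ⟨_, h', h⟩; exact ⟨by omega, h', h⟩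
    rw [h2]
    split_ifs with h
    · simp [hi]
    · rfl

theorem des_ofFn : ∀ (n : ℕ) (v : Fin n → ℕ), desStat v = desL (List.ofFn v).reverse ∧
    majStat v = majL (List.ofFn v).reverse := by
  intro n
  induction n with
  | zero => intro v; simp [desStat, majStat, desSet, desL, majL]
  | succ n ih =>
    intro v
    rcases n with _ | n
    · simp [desStat, majStat, desSet, desL, majL]
    · have h := ih (fun i => v i.castSucc)
      rw [List.ofFn_succ'] at h
      rw [List.ofFn_succ', List.ofFn_succ']
      simp only [List.concat_eq_append, List.reverse_append, List.reverse_singleton,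
        List.singleton_append, desL, majL] at h ⊢
      rw [← h.1, ← h.2]
      have hn : n + 1 ∉ desSet fun i : Fin (n + 1) => v i.castSucc := by
        rw [mem_desSet]; rintro ⟨h, _⟩; omega
      unfold desStat majStat
      rw [desSet_snoc]
      split_ifs with hlt
      · rw [Finset.card_insert_of_notMem hn, Finset.sum_insert hn]
        simp [add_comm]
      · simp

theorem des_word {m n : ℕ} (w : Fin n → Fin m) :
    desStat w = desL (List.ofFn fun i => (w i : ℕ)).reverse ∧
    majStat w = majL (List.ofFn fun i => (w i : ℕ)).reverse :=
  des_ofFn n fun i => (w i : ℕ)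

theorem word_sum {A : Type*} [CommSemiring A] (m N : ℕ) (rho : Fin m → ℕ) (hN : ∑ j, rho j = N)
    (f : ℕ → ℕ → A) :
    ∑ w ∈ multisetPerms m N rho, f (desStat w) (majStat w) =
      ((WW (List.ofFn rho)).map fun u => f (desL u) (majL u)).sum := by
  rw [← List.sum_toFinset _ (nodup_WW _)]
  have hcount : ∀ (w : Fin N → Fin m) (j : ℕ), (List.ofFn fun i => (w i : ℕ)).reverse.count j
      = (Finset.univ.filter fun i => (w i : ℕ) = j).card := by
    intro w j
    rw [List.count_reverse, ← Multiset.coe_count, ← Fin.univ_val_map, Multiset.count_map]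
    simp only [Finset.card, Finset.filter_val, eq_comm]
  refine Finset.sum_bij (fun w _ => (List.ofFn fun i => (w i : ℕ)).reverse) ?_ ?_ ?_ ?_
  · intro w hw
    simp only [multisetPerms, Finset.mem_filter, Finset.mem_univ, true_and] at hw
    rw [List.mem_toFinset, mem_WW]
    intro j
    rw [hcount]
    by_cases hj : j < m
    · rw [List.getD_eq_getElem _ _ (by simpa using hj), List.getElem_ofFn, ← hw]
      simp only [Fin.ext_iff]
    · rw [List.getD_eq_default _ _ (by simpa using hj), Finset.card_eq_zero, Finset.filter_eq_empty_iff]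
      intro i _ h
      have := (w i).2; omega
  · intro w _ w' _ h
    have := List.ofFn_injective (List.reverse_injective h)
    funext i
    exact Fin.ext (congrFun this i)
  · intro u hu
    rw [List.mem_toFinset] at hu
    have hl := WW_length _ u hu
    rw [List.sum_ofFn, hN] at hl
    rw [mem_WW] at hu
    have hlt : ∀ x ∈ u, x < m := by
      intro x hx
      by_contra h
      have h1 := hu x
      rw [List.getD_eq_default _ _ (by simpa using h), List.count_eq_zero] at h1
      exact h1 hx
    subst hl
    have he : (List.ofFn fun i : Fin u.length => u.reverse[i.1]'(by simp)).reverse = u := by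
      have : (List.ofFn fun i : Fin u.length => u.reverse[i.1]'(by simp)) = u.reverse := by
        apply List.ext_getElem <;> simp
      rw [this, List.reverse_reverse]
    refine ⟨fun i => ⟨u.reverse[i.1]'(by simp), hlt _ (List.mem_reverse.1 (List.getElem_mem _))⟩, ?_, he⟩
    simp only [multisetPerms, Finset.mem_filter, Finset.mem_univ, true_and]
    intro j
    have h1 := hu j
    rw [List.getD_eq_getElem _ _ (by simp), List.getElem_ofFn] at h1
    rw [← h1]
    conv_rhs => rw [← he]
    rw [hcount (fun i => ⟨u.reverse[i.1]'(by simp), hlt _ (List.mem_reverse.1 (List.getElem_mem _))⟩) j]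
    simp only [Fin.ext_iff]
  · intro w _
    rw [(des_word w).1, (des_word w).2]

/- staircase -/

theorem hasStaircase_succ {n : ℕ} (c : Fin (n + 1) → ℕ) (r : ℕ) : hasStaircase c r ↔
    hasStaircase (fun i : Fin n => c i.succ) r ∨
    ∃ r', r = r' + 1 ∧ r ≤ c 0 ∧ hasStaircase (fun i : Fin n => c i.succ) r' := by
  constructor
  · rintro ⟨f, hf, h⟩
    by_cases h0 : ∃ k, f k = 0
    · right
      obtain ⟨k, hk⟩ := h0
      rcases r with _ | r
      · exact k.elim0
      have hk0 : f 0 = 0 := by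
        have := hf.monotone (Fin.zero_le k)
        rw [hk] at this
        exact Fin.le_zero_iff.1 this
      refine ⟨r, rfl, ?_, ?_⟩
      · have := h 0; rw [hk0] at this; simp at this; omega
      · have hne : ∀ k : Fin r, f k.succ ≠ 0 := by
          intro k
          have := hf (Fin.succ_pos k)
          rw [hk0] at this
          exact this.ne'
        refine ⟨fun k => (f k.succ).pred (hne k), ?_, ?_⟩
        · intro a b hab
          simp only [Fin.pred_lt_pred_iff]
          exact hf (Fin.succ_lt_succ_iff.2 hab)
        · intro k
          simp only [Fin.succ_pred]
          have := h k.succ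
          simp at this; omega
    · left
      push Not at h0
      refine ⟨fun k => (f k).pred (h0 k), ?_, ?_⟩
      · intro a b hab
        simp only [Fin.pred_lt_pred_iff]
        exact hf hab
      · intro k
        simp only [Fin.succ_pred]
        exact h k
  · rintro (⟨f, hf, h⟩ | ⟨r', rfl, h0, f, hf, h⟩)
    · exact ⟨fun k => (f k).succ, fun a b hab => Fin.succ_lt_succ_iff.2 (hf hab), h⟩
    · refine ⟨Fin.cons 0 fun k => (f k).succ, ?_, ?_⟩
      · intro a b hab
        rcases Fin.eq_zero_or_eq_succ b with rfl | ⟨b, rfl⟩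
        · exact absurd hab (by simp)
        rcases Fin.eq_zero_or_eq_succ a with rfl | ⟨a, rfl⟩
        · simp
        · simp only [Fin.cons_succ, Fin.succ_lt_succ_iff] at hab ⊢
          exact hf hab
      · intro k
        rcases Fin.eq_zero_or_eq_succ k with rfl | ⟨k, rfl⟩
        · simp; omega
        · have := h k; simp; omega

theorem hasStaircase_iff : ∀ (n : ℕ) (c : Fin n → ℕ) (r : ℕ),
    hasStaircase c r ↔ r ≤ stcL (List.ofFn c) := by
  intro n
  induction n with
  | zero =>
    intro c r
    simp only [List.ofFn_zero, stcL, Nat.le_zero]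
    constructor
    · rintro ⟨f, _⟩
      rcases r with _ | r
      · rfl
      · exact (f 0).elim0
    · rintro rfl
      exact ⟨fun k => k.elim0, fun a => a.elim0, fun a => a.elim0⟩
  | succ n ih =>
    intro c r
    rw [hasStaircase_succ, ih, List.ofFn_succ, stcL]
    constructor
    · rintro (h | ⟨r', rfl, h, h'⟩)
      · omega
      · rw [ih] at h'
        split_ifs <;> omega
    · intro h
      split_ifs at h with h1
      · rcases Nat.lt_or_ge (stcL (List.ofFn fun i => c i.succ)) r with h2 | h2
        · right
          exact ⟨r - 1, by omega, by omega, (ih _ _).2 (by omega)⟩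
        · left; exact h2
      · left; exact h

theorem stcWord_eq {n : ℕ} (c : Fin n → ℕ) : stcWord c = stcL (List.ofFn c) := by
  have : {r | hasStaircase c r} = Set.Iic (stcL (List.ofFn c)) := by
    ext r; exact hasStaircase_iff n c r
  rw [stcWord, this, csSup_Iic]

/- Lehmer code -/

theorem inv_eq_sum {n : ℕ} (w : Fin n → Fin n) : invStat w = (List.ofFn (lehmer w)).sum := by
  rw [List.sum_ofFn, invStat]
  simp only [lehmer, Finset.card_filter]
  rw [← Finset.univ_product_univ, Finset.sum_product]

theorem lehmer_bound {n : ℕ} (w : Fin n → Fin n) (i : Fin n) : lehmer w i + i + 1 ≤ n := by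
  have h : lehmer w i ≤ (Finset.Ioi i).card := by
    apply Finset.card_le_card
    intro j hj
    simp at hj ⊢; exact hj.1
  rw [Fin.card_Ioi] at h
  have := i.2
  omega

theorem lehmer_adj {n : ℕ} (σ : Equiv.Perm (Fin n)) (i : ℕ) (h : i + 1 < n) :
    lehmer (fun i => σ i) ⟨i, by omega⟩ ≤ lehmer (fun i => σ i) ⟨i + 1, h⟩ ↔
      ¬ σ ⟨i + 1, h⟩ < σ ⟨i, by omega⟩ := by
  constructor
  · intro hle hlt
    apply absurd hle
    rw [not_le]
    apply Finset.card_lt_card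
    rw [Finset.ssubset_iff_of_subset]
    · refine ⟨⟨i + 1, h⟩, ?_, by simp⟩
      simp only [Finset.mem_filter, Finset.mem_univ, true_and]
      exact ⟨by simp [Fin.lt_def], hlt⟩
    · intro j hj
      simp only [Finset.mem_filter, Finset.mem_univ, true_and] at hj ⊢
      exact ⟨lt_trans (by simp [Fin.lt_def]) hj.1, hj.2.trans hlt⟩
  · intro hlt
    apply Finset.card_le_card
    intro j hj
    simp only [Finset.mem_filter, Finset.mem_univ, true_and] at hj ⊢
    rw [not_lt] at hlt
    have hne : j ≠ ⟨i + 1, h⟩ := by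
      rintro rfl
      exact absurd hj.2 (not_lt.2 hlt)
    refine ⟨?_, lt_of_lt_of_le hj.2 hlt⟩
    have h1 := hj.1
    rw [Fin.lt_def] at h1 ⊢
    rw [Ne, Fin.ext_iff] at hne
    simp at h1 hne ⊢
    omega

theorem lehmer_alt {n : ℕ} (σ : Equiv.Perm (Fin n)) (i : Fin n) :
    lehmer (fun i => σ i) i =
      (Finset.univ.filter fun v => v < σ i ∧ ∀ j < i, σ j ≠ v).card := by
  unfold lehmer
  apply Finset.card_bij (fun j _ => σ j)
  · intro j hj
    simp only [Finset.mem_filter, Finset.mem_univ, true_and] at hj ⊢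
    refine ⟨hj.2, fun k hk h => ?_⟩
    have := σ.injective h
    subst this
    exact absurd hk (not_lt.2 hj.1.le)
  · intro a _ b _ h; exact σ.injective h
  · intro v hv
    simp only [Finset.mem_filter, Finset.mem_univ, true_and] at hv
    refine ⟨σ.symm v, ?_, by simp⟩
    simp only [Finset.mem_filter, Finset.mem_univ, true_and, Equiv.apply_symm_apply]
    refine ⟨?_, hv.1⟩
    by_contra hlt
    rw [not_lt] at hlt
    rcases hlt.lt_or_eq with h | h
    · exact hv.2 _ h (by simp)
    · rw [← h] at hv; simp at hv

theorem lehmer_inj {n : ℕ} (σ τ : Equiv.Perm (Fin n))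
    (h : lehmer (fun i => σ i) = lehmer (fun i => τ i)) : σ = τ := by
  have key : ∀ (σ τ : Equiv.Perm (Fin n)) (i : Fin n), (∀ j < i, σ j = τ j) → σ i < τ i →
      lehmer (fun i => σ i) i < lehmer (fun i => τ i) i := by
    intro σ τ i hj hlt
    rw [lehmer_alt, lehmer_alt]
    apply Finset.card_lt_card
    rw [Finset.ssubset_iff_of_subset]
    · refine ⟨σ i, ?_, by simp⟩
      simp only [Finset.mem_filter, Finset.mem_univ, true_and]
      refine ⟨hlt, fun j hji he => ?_⟩
      rw [← hj j hji] at he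
      exact hji.ne (σ.injective he)
    · intro v hv
      simp only [Finset.mem_filter, Finset.mem_univ, true_and] at hv ⊢
      exact ⟨hv.1.trans hlt, fun j hji => by rw [← hj j hji]; exact hv.2 j hji⟩
  have : ∀ i, σ i = τ i := by
    intro i
    induction i using WellFoundedLT.induction with
    | _ i ih =>
      rcases lt_trichotomy (σ i) (τ i) with hl | he | hg
      · exact absurd (congrFun h i) (key σ τ i ih hl).ne
      · exact he
      · exact absurd (congrFun h i) (key τ σ i (fun j hj => (ih j hj).symm) hg).ne'
  exact Equiv.ext this

theorem lehmer_surj {n : ℕ} (c : Fin n → ℕ) (hc : ∀ i, c i + i + 1 ≤ n) :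
    ∃ σ : Equiv.Perm (Fin n), lehmer (fun i => σ i) = c := by
  let F : Equiv.Perm (Fin n) → ((i : Fin n) → Fin (n - i)) := fun σ i =>
    ⟨lehmer (fun i => σ i) i, by have := lehmer_bound (fun i => σ i) i; omega⟩
  have hF : Function.Injective F := by
    intro σ τ h
    apply lehmer_inj
    funext i
    have := congrFun h i
    simpa [F] using this
  have hcard : Fintype.card (Equiv.Perm (Fin n)) = Fintype.card ((i : Fin n) → Fin (n - i)) := by
    rw [Fintype.card_perm, Fintype.card_pi]
    simp only [Fintype.card_fin]
    rw [Fin.prod_univ_eq_prod_range (fun i => n - i) n, ← Nat.descFactorial_eq_prod_range,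
      Nat.descFactorial_self]
  have hb := (Fintype.bijective_iff_injective_and_card F).2 ⟨hF, hcard⟩
  obtain ⟨σ, hσ⟩ := hb.2 (fun i => ⟨c i, by have := hc i; omega⟩)
  refine ⟨σ, ?_⟩
  funext i
  have := congrFun hσ i
  simpa [F] using this

theorem partialSums_mem (m : ℕ) (rho : Fin m → ℕ) (i : ℕ) (hi : i + 1 < ∑ j, rho j) :
    i + 1 ∈ partialSums m rho ↔ ∃ k, ((List.ofFn rho).take k).sum = i + 1 := by
  have hts : ∀ k, ((List.ofFn rho).take (k + 1)).sum =
      ∑ j ∈ Finset.univ.filter (fun j : Fin m => (j : ℕ) ≤ k), rho j := by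
    intro k
    rw [List.sum_take_ofFn]
    apply Finset.sum_congr _ (fun _ _ => rfl)
    ext j; simp [Nat.lt_succ_iff]
  unfold partialSums
  simp only [Finset.mem_image, Finset.mem_range]
  constructor
  · rintro ⟨k, _, h⟩
    exact ⟨k + 1, (hts k).trans h⟩
  · rintro ⟨k, h⟩
    rcases k with _ | k
    · simp at h
    by_cases hk : k < m - 1
    · exact ⟨k, hk, (hts k).symm.trans h⟩
    · rw [List.take_of_length_le (by simp; omega), List.sum_ofFn] at h
      omega

theorem perm_sum {A : Type*} [CommSemiring A] (m N : ℕ) (rho : Fin m → ℕ) (hN : ∑ j, rho j = N)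
    (f : ℕ → ℕ → A) :
    ∑ σ ∈ quotientByR N (partialSums m rho), f (stcStat fun i => σ i) (invStat fun i => σ i) =
      ((CC (List.ofFn rho)).map fun l => f (stcL l) l.sum).sum := by
  rw [← List.sum_toFinset _ (nodup_CC _)]
  have hs : (List.ofFn rho).sum = N := by rw [List.sum_ofFn, hN]
  have hmem : ∀ σ : Equiv.Perm (Fin N), σ ∈ quotientByR N (partialSums m rho) ↔
      List.ofFn (lehmer fun i => σ i) ∈ CC (List.ofFn rho) := by
    intro σ
    rw [mem_CC, hs]
    have hg : ∀ i (hi : i < N), (List.ofFn (lehmer fun i => σ i)).getD i 0 =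
        lehmer (fun i => σ i) ⟨i, hi⟩ := by
      intro i hi
      rw [List.getD_eq_getElem _ _ (by simpa using hi), List.getElem_ofFn]
    simp only [quotientByR, Finset.mem_filter, Finset.mem_univ, true_and]
    constructor
    · intro h
      refine ⟨by simp, ?_, ?_⟩
      · intro i hi
        rw [hg i hi]; exact lehmer_bound (fun i => σ i) ⟨i, hi⟩
      · intro i hi hk
        rw [hg i (by omega), hg (i+1) hi, lehmer_adj]
        intro hlt
        have h1 : i + 1 ∈ partialSums m rho := by
          apply h
          rw [mem_desSet]
          exact ⟨hi, by omega, hlt⟩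
        rw [partialSums_mem m rho i (by omega)] at h1
        obtain ⟨k, h1⟩ := h1
        exact hk k h1
    · rintro ⟨-, -, h⟩ i hi
      rw [mem_desSet] at hi
      obtain ⟨hi, h1, hlt⟩ := hi
      obtain ⟨i, rfl⟩ : ∃ i', i = i' + 1 := ⟨i - 1, by omega⟩
      by_contra hn
      rw [partialSums_mem m rho i (by omega)] at hn
      push Not at hn
      have h2 := h i hi hn
      rw [hg i (by omega), hg (i+1) hi, lehmer_adj] at h2
      exact h2 hlt
  refine Finset.sum_bij (fun σ _ => List.ofFn (lehmer fun i => σ i)) ?_ ?_ ?_ ?_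
  · intro σ hσ
    rw [List.mem_toFinset]
    exact (hmem σ).1 hσ
  · intro σ _ τ _ h
    exact lehmer_inj σ τ (List.ofFn_injective h)
  · intro l hl
    rw [List.mem_toFinset] at hl
    have hl' := (mem_CC _ l).1 hl
    rw [hs] at hl'
    obtain ⟨h1, h2, -⟩ := hl'
    obtain ⟨σ, hσ⟩ := lehmer_surj (fun i : Fin N => l.getD i 0) (fun i => h2 i i.2)
    have he : List.ofFn (lehmer fun i => σ i) = l := by
      rw [hσ]
      apply List.ext_getElem
      · simp [h1]
      · intro i hi hi'
        rw [List.getElem_ofFn, List.getD_eq_getElem _ _ hi']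
    exact ⟨σ, (hmem σ).2 (he ▸ hl), he⟩
  · intro σ _
    rw [inv_eq_sum, stcStat, stcWord_eq]

end DM

/-- `(des, maj)` on multiset permutations of `{1^{ρ_1}, …, m^{ρ_m}}` is equidistributed
with `(stc, inv)` on the quotient `S_N^R`, where `R` is the set of partial sums of `ρ`. -/
theorem des_maj_multiset_equidistributed_stc_inv_quotient
    (m N : ℕ) (rho : Fin m → ℕ) (hpos : ∀ j, 0 < rho j) (hN : ∑ j, rho j = N) :
    ∑ w ∈ multisetPerms m N rho, xP ^ desStat w * qP ^ majStat w =
      ∑ σ ∈ quotientByR N (partialSums m rho),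
        xP ^ stcStat (fun i => σ i) * qP ^ invStat (fun i => σ i) := by
  rw [DM.word_sum m N rho hN fun d k => xP ^ d * qP ^ k,
    DM.perm_sum m N rho hN fun d k => xP ^ d * qP ^ k]
  exact DM.main_list qP (List.ofFn rho) fun d => xP ^ d
end

section
/- Let rho be a composition of N and define mstc(w) = stc(istd(w)) for w in S_rho, where istd(w) = (std_rho(w))^{-1}. Then the pair (mstc, inv) on S_rho is equidistributed with (des, maj) on S_rho: sum over w in S_rho of x^{mstc(w)} q^{inv(w)} equals sum over w in S_rho of x^{des(w)} q^{maj(w)}. -/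
open Finset

namespace MstcAux

section core
variable {R : Type*} [CommRing R]

/-- Block transfer function. -/
def K (q : R) (F : ℕ → R) : ℕ → ℕ → ℕ → R
  | s, _, 0 => F s
  | s, 0, _ + 1 => F s
  | s, M + 1, r + 1 =>
      K q F s M (r + 1) + q ^ (M + 1) * K q F (if s < M + 1 then s + 1 else s) (M + 1) r
termination_by s M r => (r, M)

theorem K_zero_right (q : R) (F : ℕ → R) (s M : ℕ) : K q F s M 0 = F s := by
  cases M <;> simp [K]

theorem K_zero_mid (q : R) (F : ℕ → R) (s r : ℕ) : K q F s 0 r = F s := by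
  cases r <;> simp [K]

theorem K_succ (q : R) (F : ℕ → R) (s M r : ℕ) : K q F s (M + 1) (r + 1) =
    K q F s M (r + 1) + q ^ (M + 1) * K q F (if s < M + 1 then s + 1 else s) (M + 1) r := by
  rw [K]

theorem K_shift (q : R) (F : ℕ → R) (r : ℕ) : ∀ M s : ℕ, K q F (s + 1) (M + 1) (r + 1) =
    K q F (s + 1) (M + 1) r + q ^ (r + 1) * K q (fun t => F (t + 1)) s M (r + 1) := by
  induction r with
  | zero =>
    intro M
    induction M with
    | zero => intro s; simp [K_succ, K_zero_mid, K_zero_right]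
    | succ M ih =>
      intro s
      rw [K_succ, ih, K_succ q _ s M 0]
      simp only [K_zero_right]
      by_cases h : s < M + 1
      · simp only [h, add_lt_add_iff_right, if_true]; ring
      · simp only [h, add_lt_add_iff_right, if_false]; ring
  | succ r ihr =>
    intro M
    induction M with
    | zero =>
      intro s
      have h1 := K_succ q F (s + 1) 0 (r + 1)
      have h2 := K_succ q F (s + 1) 0 r
      have h3 := ihr 0 s
      simp [K_zero_mid] at h1 h2 h3 ⊢
      linear_combination h1 - h2 + q * h3
    | succ M ih =>
      intro s
      rw [K_succ, ih, K_succ q _ s M (r + 1), K_succ q F (s+1) (M+1) r]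
      by_cases h : s < M + 1
      · have := ihr (M + 1) (s + 1)
        simp only [h, add_lt_add_iff_right, if_true]
        rw [this]; ring
      · have := ihr (M + 1) s
        simp only [h, add_lt_add_iff_right, if_false]
        rw [this]; ring

/-- Reversed words: the head is the last letter. -/
def desL : List ℕ → ℕ
  | [] => 0
  | [_] => 0
  | a :: b :: l => desL (b :: l) + if a < b then 1 else 0

def majL : List ℕ → ℕ
  | [] => 0
  | [_] => 0
  | a :: b :: l => majL (b :: l) + if a < b then l.length + 1 else 0

/-- All insertions of `r` copies of `z` in the word `u`. -/
def ins (z : ℕ) : List ℕ → ℕ → List (List ℕ)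
  | [], r => [List.replicate r z]
  | c :: u, 0 => [c :: u]
  | c :: u, r + 1 => (ins z (c :: u) r).map (fun w => z :: w) ++ (ins z u (r + 1)).map (fun w => c :: w)
termination_by u r => (u.length, r)

theorem ins_zero (z : ℕ) (u : List ℕ) : ins z u 0 = [u] := by
  cases u <;> simp [ins]

theorem ins_nil (z r : ℕ) : ins z [] r = [List.replicate r z] := by
  simp [ins]

theorem ins_succ (z c : ℕ) (u : List ℕ) (r : ℕ) : ins z (c :: u) (r + 1) =
    (ins z (c :: u) r).map (fun w => z :: w) ++ (ins z u (r + 1)).map (fun w => c :: w) := by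
  rw [ins]

theorem mem_ins (z : ℕ) (u : List ℕ) (r : ℕ) (hz : z ∉ u) (w : List ℕ) :
    w ∈ ins z u r ↔ w.filter (fun a => a ≠ z) = u ∧ w.count z = r := by
  induction w generalizing u r with
  | nil =>
    cases u with
    | nil => cases r <;> simp [ins_nil, List.replicate_succ]
    | cons c u => cases r <;> simp [ins_zero, ins_succ]
  | cons a w ih =>
    cases u with
    | nil =>
      rw [ins_nil]
      cases r with
      | zero =>
        by_cases h : a = z <;> simp [h]
      | succ r =>
        have := ih [] r (by simp)
        rw [ins_nil] at this
        by_cases h : a = z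
        · subst h
          simp [List.replicate_succ] at this ⊢
          exact this
        · simp [h, List.replicate_succ]
    | cons c u =>
      have hc : c ≠ z := by rintro rfl; simp at hz
      have hu : z ∉ u := by intro h; exact hz (by simp [h])
      cases r with
      | zero =>
        rw [ins_zero]
        have := ih u 0 hu
        rw [ins_zero] at this
        by_cases h : a = z
        · subst h; simp [hc.symm]
        · simp [h] at this ⊢
          rw [this]; tauto
      | succ r =>
        have h1 := ih (c :: u) r hz
        have h2 := ih u (r + 1) hu
        rw [ins_succ]
        by_cases h : a = z
        · subst h
          simp at h1 ⊢
          rw [h1]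
          constructor
          · rintro (h | ⟨_, h⟩)
            · exact h
            · exact absurd h hc
          · exact fun h => Or.inl h
        · simp [h] at h2 ⊢
          rw [h2]
          constructor
          · rintro (⟨_, h'⟩ | ⟨h', rfl⟩)
            · exact absurd h'.symm h
            · simp [h']
          · rintro ⟨⟨rfl, h'⟩, hcnt⟩
            exact Or.inr ⟨⟨h', hcnt⟩, rfl⟩

theorem nodup_ins (z : ℕ) (u : List ℕ) (r : ℕ) (hz : z ∉ u) : (ins z u r).Nodup := by
  induction u generalizing r with
  | nil => simp [ins_nil]
  | cons c u ihu =>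
    have hc : z ≠ c := by rintro rfl; simp at hz
    have hu : z ∉ u := by intro h; exact hz (by simp [h])
    induction r with
    | zero => simp [ins_zero]
    | succ r ihr =>
      rw [ins_succ, List.nodup_append]
      refine ⟨ihr.map (fun _ _ h => by simpa using h),
        (ihu (r + 1) hu).map (fun _ _ h => by simpa using h), ?_⟩
      intro a ha b hb
      simp at ha hb
      obtain ⟨a, _, rfl⟩ := ha
      obtain ⟨b, _, rfl⟩ := hb
      simp [hc]

/-- All words with `rs[i]` copies of the letter `z + i`. -/
def words : ℕ → List ℕ → List (List ℕ)
  | _, [] => [[]]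
  | z, r :: rs => (words (z + 1) rs).flatMap (fun u => ins z u r)

theorem length_of_mem_ins {z r : ℕ} {u w : List ℕ} (hz : z ∉ u) (h : w ∈ ins z u r) :
    w.length = u.length + r := by
  rw [mem_ins z u r hz] at h
  obtain ⟨rfl, rfl⟩ := h
  have := w.length_eq_countP_add_countP (fun a => decide (a ≠ z))
  rw [this, List.countP_eq_length_filter]
  simp [List.count, beq_eq_decide]

theorem words_spec (rs : List ℕ) : ∀ z : ℕ, (words z rs).Nodup ∧ ∀ w, w ∈ words z rs ↔
    ∀ a, w.count a = if z ≤ a then rs.getD (a - z) 0 else 0 := by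
  induction rs with
  | nil =>
    intro z
    refine ⟨by simp [words], fun w => ?_⟩
    simp only [words, List.mem_singleton]
    constructor
    · rintro rfl; simp
    · intro h
      rw [List.eq_nil_iff_forall_not_mem]
      intro a ha
      have := List.count_pos_iff.2 ha
      have h2 := h a
      simp at h2
      omega
  | cons r rs ih =>
    intro z
    obtain ⟨hnd, hm⟩ := ih (z + 1)
    have hnot : ∀ u ∈ words (z + 1) rs, z ∉ u := by
      intro u hu hz
      have h1 := (hm u).1 hu z
      have h2 := List.count_pos_iff.2 hz
      simp at h1
      omega
    constructor
    · rw [words, List.nodup_flatMap]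
      refine ⟨fun u hu => nodup_ins z u r (hnot u hu), ?_⟩
      refine hnd.imp_of_mem ?_
      intro a b ha hb hab w hwa hwb
      simp only [] at hwa hwb
      rw [mem_ins z _ r (hnot _ ha)] at hwa
      rw [mem_ins z _ r (hnot _ hb)] at hwb
      exact hab (hwa.1.symm.trans hwb.1)
    · intro w
      rw [words, List.mem_flatMap]
      constructor
      · rintro ⟨u, hu, hw⟩ a
        rw [mem_ins z u r (hnot u hu)] at hw
        have h1 := (hm u).1 hu a
        rcases lt_trichotomy a z with h | h | h
        · rw [← hw.1, List.count_filter (by simp; omega)] at h1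
          rw [h1]; simp; split_ifs <;> omega
        · subst h; simp [hw.2]
        · rw [← hw.1, List.count_filter (by simp; omega)] at h1
          obtain ⟨k, rfl⟩ : ∃ k, a = z + 1 + k := ⟨a - z - 1, by omega⟩
          rw [h1, if_pos (by omega), if_pos (by omega)]
          have : z + 1 + k - z = k + 1 := by omega
          rw [this]; simp
      · intro h
        have hu : w.filter (fun a => a ≠ z) ∈ words (z + 1) rs := by
          rw [hm]
          intro a
          by_cases haz : a = z
          · subst haz; simp [List.count_eq_zero]
          · rw [List.count_filter (by simpa using haz), h a]
            by_cases hlt : z + 1 ≤ a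
            · obtain ⟨k, rfl⟩ : ∃ k, a = z + 1 + k := ⟨a - z - 1, by omega⟩
              rw [if_pos (by omega), if_pos (by omega)]
              have : z + 1 + k - z = k + 1 := by omega
              rw [this]; simp
            · rw [if_neg (by omega), if_neg (by omega)]
        refine ⟨_, hu, ?_⟩
        rw [mem_ins z _ r (hnot _ hu)]
        refine ⟨rfl, ?_⟩
        have := h z
        simpa using this

theorem words_gt {z : ℕ} {rs : List ℕ} {u : List ℕ} (hu : u ∈ words (z + 1) rs) :
    ∀ a ∈ u, z < a := by
  intro a ha
  have h1 := ((words_spec rs (z + 1)).2 u).1 hu a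
  have h2 := List.count_pos_iff.2 ha
  by_contra hlt
  rw [if_neg (by omega)] at h1
  omega

theorem words_length {rs : List ℕ} : ∀ {z : ℕ} {u : List ℕ}, u ∈ words z rs →
    u.length = rs.sum := by
  induction rs with
  | nil => intro z u hu; simp [words] at hu; simp [hu]
  | cons r rs ih =>
    intro z u hu
    rw [words, List.mem_flatMap] at hu
    obtain ⟨v, hv, hu⟩ := hu
    have : z ∉ v := fun h => lt_irrefl _ (words_gt hv z h)
    rw [length_of_mem_ins this hu, ih hv]; simp [add_comm]

/-- Code of the letter `z`, read from right to left. -/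
def codeL (z : ℕ) : List ℕ → List ℕ
  | [] => []
  | a :: t => if a = z then (t.countP (fun b => z < b)) :: codeL z t else codeL z t

def codeAll : ℕ → ℕ → List ℕ → List ℕ
  | _, 0, _ => []
  | z, k + 1, l => codeAll (z + 1) k l ++ codeL z l

def greedy (s : ℕ) (l : List ℕ) : ℕ := l.foldl (fun s a => if s < a then s + 1 else s) s

theorem codeL_filter (z a : ℕ) (h : z < a) (l : List ℕ) :
    codeL a (l.filter (fun b => b ≠ z)) = codeL a l := by
  induction l with
  | nil => rfl
  | cons b l ih =>
    by_cases hb : b = z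
    · subst hb
      rw [List.filter_cons_of_neg (by simp), ih]
      simp [codeL, h.ne]
    · rw [List.filter_cons_of_pos (by simpa using hb)]
      simp only [codeL, ih]
      congr 2
      rw [List.countP_filter]
      apply List.countP_congr
      intro x _
      simp; omega

theorem codeAll_filter (z : ℕ) (k : ℕ) : ∀ a : ℕ, z < a → ∀ l : List ℕ,
    codeAll a k (l.filter (fun b => b ≠ z)) = codeAll a k l := by
  induction k with
  | zero => intro a _ l; rfl
  | succ k ih =>
    intro a h l
    rw [codeAll, codeAll, codeL_filter z a h, ih (a + 1) (by omega)]

theorem greedy_cons (s a : ℕ) (l : List ℕ) :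
    greedy s (a :: l) = greedy (if s < a then s + 1 else s) l := rfl

theorem greedy_append (s : ℕ) (l l' : List ℕ) :
    greedy s (l ++ l') = greedy (greedy s l) l' := by
  simp [greedy, List.foldl_append]

theorem stc_ins (q : R) (F : ℕ → R) (z : ℕ) (u : List ℕ) (hz : ∀ a ∈ u, z < a) (r : ℕ) : ∀ s : ℕ,
    ((ins z u r).map (fun w => q ^ (codeL z w).sum * F (greedy s (codeL z w)))).sum
      = K q F s u.length r := by
  have h0 : ∀ u : List ℕ, (∀ a ∈ u, z < a) → codeL z u = [] := by
    intro u hu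
    induction u with
    | nil => rfl
    | cons a u ih =>
      have := hu a (by simp)
      rw [codeL, if_neg (by omega), ih (fun b hb => hu b (by simp [hb]))]
  induction u generalizing r with
  | nil =>
    intro s
    have h1 : ∀ s, q ^ (codeL z (List.replicate r z)).sum *
        F (greedy s (codeL z (List.replicate r z))) = F s := by
      induction r with
      | zero => intro s; simp [codeL, greedy]
      | succ r ih =>
        intro s
        have h2 : (List.replicate r z).countP (fun b => z < b) = 0 := by
          rw [List.countP_eq_zero]
          intro a ha; simp [List.eq_of_mem_replicate ha]
        rw [List.replicate_succ, codeL, if_pos rfl, h2, greedy_cons]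
        simpa using ih s
    simp [ins_nil, K_zero_mid, h1]
  | cons c u ihu =>
    have hc := hz c (by simp)
    have hu : ∀ a ∈ u, z < a := fun a ha => hz a (by simp [ha])
    have hzu : z ∉ c :: u := fun h => lt_irrefl _ (hz z h)
    induction r with
    | zero => intro s; simp [ins_zero, K_zero_right, h0 _ hz, greedy]
    | succ r ihr =>
      intro s
      rw [ins_succ, List.map_append, List.sum_append, List.length_cons, K_succ, ← ihu hu,
        ← List.length_cons (a := c), ← ihr,
        List.map_map, List.map_map, add_comm, ← List.sum_map_mul_left]
      congr 2
      · apply List.map_congr_left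
        intro w _
        simp [codeL, hc.ne']
      · apply List.map_congr_left
        intro w hw
        have h3 : w.countP (fun b => z < b) = u.length + 1 := by
          rw [mem_ins z _ _ hzu] at hw
          have h4 : (c :: u).countP (fun b => z < b) = (c :: u).length := by
            rw [List.countP_eq_length]; simpa using hz
          have h5 := h4
          rw [← hw.1, List.countP_filter] at h5
          rw [hw.1] at h5
          rw [← List.length_cons (a := c), ← h5]
          apply List.countP_congr
          intro x _; simp; omega
        simp only [Function.comp, codeL, if_true, h3, greedy_cons, List.sum_cons, List.length_cons]
        ring

theorem desL_lt (c : ℕ) (u : List ℕ) : desL (c :: u) < u.length + 1 := by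
  induction u generalizing c with
  | nil => simp [desL]
  | cons b u ih =>
    have := ih b
    rw [desL, List.length_cons]
    split_ifs <;> omega


theorem des_ins_E (q : R) (z c : ℕ) (u : List ℕ) (hz : ∀ a ∈ c :: u, z < a)
    (H : ∀ (F : ℕ → R) (r : ℕ), ((ins z u r).map
      (fun w => q ^ majL (c :: w) * F (desL (c :: w)))).sum
        = q ^ majL (c :: u) * K q F (desL (c :: u)) u.length r) (F : ℕ → R) (r : ℕ) :
    ((ins z (c :: u) r).map
      (fun w => q ^ majL (z :: w) * F (desL (z :: w)))).sum
        = q ^ (majL (c :: u) + (u.length + 1)) * K q F (desL (c :: u) + 1) (u.length + 1) r := by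
  have hc := hz c (by simp)
  have hzu : z ∉ u := fun h => lt_irrefl _ (hz z (by simp [h]))
  induction r with
  | zero => simp [ins_zero, K_zero_right, majL, desL, hc]
  | succ r ih =>
    rw [K_shift, mul_add, ← ih, ins_succ, List.map_append, List.sum_append, List.map_map,
      List.map_map]
    congr 1
    · congr 1
      apply List.map_congr_left
      intro w _
      simp [majL, desL]
    · have h := H (fun t => F (t + 1)) (r + 1)
      have h2 : q ^ (majL (c :: u) + (u.length + 1)) * (q ^ (r + 1) *
          K q (fun t => F (t + 1)) (desL (c :: u)) u.length (r + 1)) =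
          q ^ (u.length + 1 + (r + 1)) * (q ^ majL (c :: u) *
          K q (fun t => F (t + 1)) (desL (c :: u)) u.length (r + 1)) := by ring
      rw [h2, ← h, ← List.sum_map_mul_left]
      congr 1
      apply List.map_congr_left
      intro w hw
      have hl := length_of_mem_ins hzu hw
      simp only [Function.comp, majL, desL, hc, if_true, hl]
      ring

theorem des_ins_H (q : R) (z : ℕ) (u : List ℕ) : ∀ c : ℕ, (∀ a ∈ c :: u, z < a) →
    ∀ (F : ℕ → R) (r : ℕ), ((ins z u r).map
      (fun w => q ^ majL (c :: w) * F (desL (c :: w)))).sum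
        = q ^ majL (c :: u) * K q F (desL (c :: u)) u.length r := by
  induction u with
  | nil =>
    intro c hz F r
    have hc := hz c (by simp)
    have h1 : ∀ r, majL (List.replicate r z) = 0 ∧ desL (List.replicate r z) = 0 := by
      intro r
      induction r with
      | zero => simp [majL, desL]
      | succ r ih =>
        cases r with
        | zero => simp [majL, desL]
        | succ r => simpa [majL, desL, List.replicate_succ] using ih
    cases r with
    | zero => simp [ins_nil, K_zero_mid, majL, desL]
    | succ r =>
      have := h1 (r + 1)
      rw [List.replicate_succ] at this
      simp [ins_nil, K_zero_mid, List.replicate_succ, majL, desL, this, hc.not_gt]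
  | cons b u ih =>
    intro c hz F r
    have hc := hz c (by simp)
    have hzb : ∀ a ∈ b :: u, z < a := fun a ha => hz a (by simp at ha ⊢; tauto)
    have hzu : z ∉ u := fun h => lt_irrefl _ (hz z (by simp [h]))
    have H := ih b hzb
    have E := des_ins_E q z b u hzb H
    cases r with
    | zero => simp [ins_zero, K_zero_right]
    | succ r =>
      rw [ins_succ, List.map_append, List.sum_append, List.map_map, List.map_map]
      have e1 : ((ins z (b :: u) r).map
          ((fun w => q ^ majL (c :: w) * F (desL (c :: w))) ∘ fun w => z :: w)) =
          (ins z (b :: u) r).map (fun w => q ^ majL (z :: w) * F (desL (z :: w))) := by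
        apply List.map_congr_left
        intro w _
        simp [majL, desL, hc.not_gt]
      rw [e1, E]
      have hs := desL_lt b u
      by_cases hcb : c < b
      · have e2 : ((ins z u (r + 1)).map
            ((fun w => q ^ majL (c :: w) * F (desL (c :: w))) ∘ fun w => b :: w)) =
            (ins z u (r + 1)).map (fun w => q ^ (u.length + 1 + (r + 1)) *
              (q ^ majL (b :: w) * (fun t => F (t + 1)) (desL (b :: w)))) := by
          apply List.map_congr_left
          intro w hw
          have hl := length_of_mem_ins hzu hw
          simp only [Function.comp, majL, desL, hcb, if_true, hl]
          ring
        rw [e2, List.sum_map_mul_left, H (fun t => F (t + 1)) (r + 1)]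
        simp only [majL, desL, hcb, if_true, List.length_cons]
        rw [K_shift]
        ring
      · have e2 : ((ins z u (r + 1)).map
            ((fun w => q ^ majL (c :: w) * F (desL (c :: w))) ∘ fun w => b :: w)) =
            (ins z u (r + 1)).map (fun w =>
              (q ^ majL (b :: w) * F (desL (b :: w)))) := by
          apply List.map_congr_left
          intro w hw
          simp only [Function.comp, majL, desL, hcb, if_false, add_zero]
        rw [e2, H]
        simp only [majL, desL, hcb, if_false, add_zero, List.length_cons]
        rw [K_succ, if_pos hs]
        ring

theorem des_ins (q : R) (z : ℕ) (u : List ℕ) (hz : ∀ a ∈ u, z < a) (F : ℕ → R) (r : ℕ) :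
    ((ins z u r).map (fun w => q ^ majL w * F (desL w))).sum
        = q ^ majL u * K q F (desL u) u.length r := by
  cases u with
  | nil =>
    have h1 : ∀ r, majL (List.replicate r z) = 0 ∧ desL (List.replicate r z) = 0 := by
      intro r
      induction r with
      | zero => simp [majL, desL]
      | succ r ih =>
        cases r with
        | zero => simp [majL, desL]
        | succ r => simpa [majL, desL, List.replicate_succ] using ih
    simp [ins_nil, K_zero_mid, h1, majL, desL]
  | cons c u =>
    cases r with
    | zero => simp [ins_zero, K_zero_right]
    | succ r =>
      have H := des_ins_H q z u c hz
      have E := des_ins_E q z c u hz H F r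
      rw [ins_succ, List.map_append, List.sum_append, List.map_map, List.map_map]
      have E' : ((ins z (c :: u) r).map
        ((fun w => q ^ majL w * F (desL w)) ∘ fun w => z :: w)).sum = _ := E
      have H' : ((ins z u (r + 1)).map
        ((fun w => q ^ majL w * F (desL w)) ∘ fun w => c :: w)).sum = _ := H F (r + 1)
      rw [E', H', List.length_cons, K_succ, if_pos (desL_lt c u)]
      ring

theorem list_sum_flatMap {α β : Type*} (l : List α) (g : α → List β) (f : β → R) :
    ((l.flatMap g).map f).sum = (l.map (fun a => ((g a).map f).sum)).sum := by
  induction l with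
  | nil => simp
  | cons a l ih => simp [ih]

theorem main_words (q : R) (rs : List ℕ) : ∀ (z : ℕ) (F : ℕ → R),
    ((words z rs).map (fun w => q ^ (codeAll z rs.length w).sum *
      F (greedy 0 (codeAll z rs.length w)))).sum =
    ((words z rs).map (fun w => q ^ majL w * F (desL w))).sum := by
  induction rs with
  | nil => intro z F; simp [words, codeAll, greedy, majL, desL]
  | cons r rs ih =>
    intro z F
    rw [words, list_sum_flatMap, list_sum_flatMap]
    have h1 : ∀ u ∈ words (z + 1) rs,
        ((ins z u r).map (fun w => q ^ majL w * F (desL w))).sum =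
        q ^ majL u * (fun s => K q F s rs.sum r) (desL u) := by
      intro u hu
      rw [des_ins q z u (words_gt hu), words_length hu]
    have h2 : ∀ u ∈ words (z + 1) rs,
        ((ins z u r).map (fun w => q ^ (codeAll z (r :: rs).length w).sum *
          F (greedy 0 (codeAll z (r :: rs).length w)))).sum =
        q ^ (codeAll (z + 1) rs.length u).sum *
          (fun s => K q F s rs.sum r) (greedy 0 (codeAll (z + 1) rs.length u)) := by
      intro u hu
      have hz := words_gt hu
      simp only []
      rw [← words_length hu, ← stc_ins q F z u hz, ← List.sum_map_mul_left]
      congr 1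
      apply List.map_congr_left
      intro w hw
      rw [mem_ins z u r (fun h => lt_irrefl _ (hz z h))] at hw
      have : codeAll (z + 1) rs.length w = codeAll (z + 1) rs.length u := by
        rw [← hw.1, codeAll_filter z _ _ (by omega)]
      rw [List.length_cons, codeAll, this, greedy_append, List.sum_append]
      ring
    rw [List.map_congr_left h1, List.map_congr_left h2]
    exact ih (z + 1) (fun s => K q F s rs.sum r)

end core
end MstcAux

namespace MstcAux

/-- Extension of a word by zero. -/
def ext {m N : ℕ} (w : Fin N → Fin m) (i : ℕ) : ℕ := if h : i < N then (w ⟨i, h⟩ : ℕ) else 0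

/-- The reversed list of the first `n` values. -/
def L (v : ℕ → ℕ) (n : ℕ) : List ℕ := ((List.range n).map v).reverse

theorem ext_val {m N : ℕ} (w : Fin N → Fin m) (i : Fin N) : ext w i = w i := by
  simp [ext]

theorem L_succ (v : ℕ → ℕ) (n : ℕ) : L v (n + 1) = v n :: L v n := by
  simp [L, List.range_succ]

theorem L_length (v : ℕ → ℕ) (n : ℕ) : (L v n).length = n := by simp [L]

theorem des_maj_L (v : ℕ → ℕ) (n : ℕ) :
    desL (L v n) = ((Finset.Ico 1 n).filter fun i => v i < v (i - 1)).card ∧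
    majL (L v n) = ∑ i ∈ (Finset.Ico 1 n).filter (fun i => v i < v (i - 1)), i := by
  induction n with
  | zero => simp [L, desL, majL]
  | succ n ih =>
    cases n with
    | zero => simp [L, desL, majL]
    | succ n =>
      have h1 : (Finset.Ico 1 (n + 1 + 1)) = insert (n + 1) (Finset.Ico 1 (n + 1)) := by
        ext i; simp only [Finset.mem_Ico, Finset.mem_insert]; omega
      have h2 : n + 1 ∉ (Finset.Ico 1 (n + 1)).filter (fun i => v i < v (i - 1)) := by simp
      have h3 := L_length v n
      rw [L_succ, L_succ, desL, majL, ← L_succ, ih.1, ih.2, h1, Finset.filter_insert]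
      by_cases h : v (n + 1) < v n
      · simp only [h, add_tsub_cancel_right, if_true]
        rw [Finset.card_insert_of_notMem h2, Finset.sum_insert h2, h3]
        exact ⟨rfl, by ring⟩
      · simp [h]

theorem desSet_eq {m N : ℕ} (w : Fin N → Fin m) :
    desSet w = (Finset.Ico 1 N).filter fun i => ext w i < ext w (i - 1) := by
  ext i
  simp only [desSet, Finset.mem_filter, Finset.mem_Ico]
  constructor
  · rintro ⟨h, h1, h2⟩
    refine ⟨h, ?_⟩
    rw [ext, ext, dif_pos h1, dif_pos (by omega)]
    exact h2
  · rintro ⟨h, h2⟩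
    refine ⟨h, h.2, ?_⟩
    rw [ext, ext, dif_pos h.2, dif_pos (by omega)] at h2
    exact h2

/-- Number of larger letters to the left. -/
def gN (v : ℕ → ℕ) (i : ℕ) : ℕ := (List.range i).countP (fun j => v i < v j)

theorem codeL_L (z : ℕ) (v : ℕ → ℕ) (n : ℕ) :
    codeL z (L v n) = (((List.range n).filter (fun i => v i = z)).map (gN v)).reverse := by
  induction n with
  | zero => simp [L, codeL]
  | succ n ih =>
    rw [L_succ, codeL, ih, List.range_succ, List.filter_append, List.map_append,
      List.reverse_append]
    by_cases h : v n = z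
    · have : (L v n).countP (fun b => z < b) = gN v n := by
        rw [L, List.countP_reverse, List.countP_map, gN, h]
        rfl
      simp [h, this]
    · simp [h]

theorem codeAll_reverse (k : ℕ) (l : List ℕ) : ∀ z : ℕ, (codeAll z k l).reverse =
    (List.range' z k).flatMap (fun a => (codeL a l).reverse) := by
  induction k with
  | zero => intro z; simp [codeAll]
  | succ k ih =>
    intro z
    rw [codeAll, List.reverse_append, ih, List.range'_succ, List.flatMap_cons]

theorem hasStaircase_iff {n : ℕ} (c : Fin n → ℕ) : ∀ r, hasStaircase c r ↔
    r ≤ greedy 0 (List.ofFn c).reverse := by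
  induction n with
  | zero =>
    intro r
    simp [greedy]
    constructor
    · rintro ⟨f, _, _⟩
      by_contra h
      exact (f ⟨0, by omega⟩).elim0
    · rintro rfl
      exact ⟨Fin.elim0, fun a => a.elim0, fun a => a.elim0⟩
  | succ n ih =>
    intro r
    have ih := ih (fun i => c i.succ)
    have hstep : hasStaircase c r ↔ hasStaircase (fun i => c i.succ) r ∨
        ∃ r', r = r' + 1 ∧ r' < c 0 ∧ hasStaircase (fun i => c i.succ) r' := by
      constructor
      · rintro ⟨f, hf, hc⟩
        by_cases h0 : ∃ k, f k = 0
        · right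
          obtain ⟨k, hk⟩ := h0
          obtain ⟨r', rfl⟩ : ∃ r', r = r' + 1 := ⟨r - 1, by have := k.2; omega⟩
          have hf0 : f 0 = 0 := by
            have := hf.monotone (Fin.zero_le k)
            rw [hk] at this
            exact Fin.le_zero_iff.1 this
          have hne : ∀ i : Fin r', f i.succ ≠ 0 := by
            intro i h
            have := hf (Fin.succ_pos i)
            rw [h, hf0] at this
            exact lt_irrefl _ this
          refine ⟨r', rfl, ?_, fun i => (f i.succ).pred (hne i), ?_, ?_⟩
          · have := hc 0
            rw [hf0] at this
            simp at this
            omega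
          · intro a b hab
            simp only [Fin.pred_lt_pred_iff]
            exact hf (Fin.succ_lt_succ_iff.2 hab)
          · intro i
            have := hc i.succ
            simp at this ⊢
            omega
        · left
          push Not at h0
          refine ⟨fun i => (f i).pred (h0 i), ?_, ?_⟩
          · intro a b hab
            simp only [Fin.pred_lt_pred_iff]
            exact hf hab
          · intro i
            have := hc i
            simpa using this
      · rintro (⟨f, hf, hc⟩ | ⟨r', rfl, h0, f, hf, hc⟩)
        · exact ⟨fun i => (f i).succ, fun a b hab => Fin.succ_lt_succ_iff.2 (hf hab), hc⟩
        · refine ⟨Fin.cons 0 (fun i => (f i).succ), ?_, ?_⟩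
          · intro a b hab
            induction b using Fin.cases with
            | zero => exact absurd hab (by simp)
            | succ b =>
              induction a using Fin.cases with
              | zero => simp
              | succ a =>
                simp only [Fin.cons_succ]
                exact Fin.succ_lt_succ_iff.2 (hf (Fin.succ_lt_succ_iff.1 hab))
          · intro k
            induction k using Fin.cases with
            | zero => simp; omega
            | succ k =>
              have := hc k
              simp at this ⊢
              omega
    rw [hstep, List.ofFn_succ, List.reverse_cons, greedy_append]
    generalize hg : greedy 0 (List.ofFn fun i => c i.succ).reverse = g at ih
    have h1 : greedy g [c 0] = if g < c 0 then g + 1 else g := rfl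
    rw [h1, ih]
    constructor
    · rintro (h | ⟨r', rfl, h2, h3⟩)
      · split_ifs <;> omega
      · rw [ih] at h3; split_ifs <;> omega
    · intro h
      by_cases h2 : r ≤ g
      · exact Or.inl h2
      · right
        split_ifs at h with h3
        · exact ⟨g, by omega, h3, by rw [ih]⟩
        · omega

theorem stcWord_eq {n : ℕ} (c : Fin n → ℕ) : stcWord c = greedy 0 (List.ofFn c).reverse := by
  have : {r | hasStaircase c r} = Set.Iic (greedy 0 (List.ofFn c).reverse) := by
    ext r; exact hasStaircase_iff c r
  rw [stcWord, this, csSup_Iic]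

theorem lehmer_sort {m N : ℕ} (w : Fin N → Fin m) (p : Fin N) :
    lehmer (fun i => (stdPerm w)⁻¹ i) p = gN (ext w) ((stdPerm w)⁻¹ p) := by
  have hm : Monotone ((fun i => toLex (w i, i)) ∘ (Tuple.sort fun i => toLex (w i, i))) :=
    Tuple.monotone_sort _
  have hs : (stdPerm w)⁻¹ = Tuple.sort fun i => toLex (w i, i) := by simp [stdPerm]
  rw [hs]
  generalize Tuple.sort (fun i => toLex (w i, i)) = σ at hm
  have hm' : StrictMono ((fun i => toLex (w i, i)) ∘ σ) := by
    apply hm.strictMono_of_injective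
    intro a b h
    simp at h
    exact h.2
  have e : gN (ext w) (σ p) = ((Finset.range (σ p)).filter
      (fun j => ext w (σ p) < ext w j)).card := by
    rw [gN, List.countP_eq_length_filter]
    rfl
  rw [e, lehmer]
  apply Finset.card_bij (fun j _ => ((σ j : Fin N) : ℕ))
  · intro j hj
    simp only [Finset.mem_filter, Finset.mem_univ, true_and, Finset.mem_range] at hj ⊢
    refine ⟨hj.2, ?_⟩
    rw [ext_val, ext_val]
    have := hm' hj.1
    simp only [Function.comp, Prod.Lex.toLex_lt_toLex] at this
    rcases this with h | h
    · exact h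
    · exact absurd h.2 (not_lt.2 hj.2.le)
  · intro a _ b _ h
    exact σ.injective (Fin.ext h)
  · intro b hb
    simp only [Finset.mem_filter, Finset.mem_range] at hb
    have hbN : b < N := hb.1.trans (σ p).2
    refine ⟨σ.symm ⟨b, hbN⟩, ?_, by simp⟩
    simp only [Finset.mem_filter, Finset.mem_univ, true_and, Equiv.apply_symm_apply]
    refine ⟨?_, hb.1⟩
    rw [← hm'.lt_iff_lt]
    simp only [Function.comp, Prod.Lex.toLex_lt_toLex, Equiv.apply_symm_apply]
    left
    have h2 := hb.2
    have h3 := ext_val w ⟨b, hbN⟩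
    simp only at h3
    rw [h3, ext_val] at h2
    exact h2

theorem ofFn_sort {m N : ℕ} (w : Fin N → Fin m) :
    List.ofFn (fun i => (stdPerm w)⁻¹ i) =
      (List.finRange m).flatMap (fun a => (List.finRange N).filter (fun i => w i = a)) := by
  have hm : Monotone ((fun i => toLex (w i, i)) ∘ (Tuple.sort fun i => toLex (w i, i))) :=
    Tuple.monotone_sort _
  have hs : (stdPerm w)⁻¹ = Tuple.sort fun i => toLex (w i, i) := by simp [stdPerm]
  rw [hs]
  generalize Tuple.sort (fun i => toLex (w i, i)) = σ at hm
  have hm' : StrictMono ((fun i => toLex (w i, i)) ∘ σ) := by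
    apply hm.strictMono_of_injective
    intro a b h
    simp at h
    exact h.2
  have p1 : (List.ofFn (fun i => σ i)).Pairwise (fun i j => toLex (w i, i) < toLex (w j, j)) := by
    rw [List.pairwise_ofFn]
    intro i j h
    exact hm' h
  have p2 : ((List.finRange m).flatMap (fun a =>
      (List.finRange N).filter (fun i => w i = a))).Pairwise
      (fun i j => toLex (w i, i) < toLex (w j, j)) := by
    rw [List.pairwise_flatMap]
    constructor
    · intro a _
      have : (List.finRange N).Pairwise (· < ·) := List.pairwise_lt_finRange N
      refine (this.filter _).imp_of_mem ?_
      intro x y hx hy hxy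
      simp at hx hy
      rw [Prod.Lex.toLex_lt_toLex]
      right
      exact ⟨by simp [hx, hy], hxy⟩
    · refine (List.pairwise_lt_finRange m).imp ?_
      intro a b hab x hx y hy
      simp at hx hy
      rw [Prod.Lex.toLex_lt_toLex]
      left
      simpa [hx, hy] using hab
  refine List.Perm.eq_of_pairwise (le := fun i j => toLex (w i, i) < toLex (w j, j)) ?_ p1 p2 ?_
  · intro a b _ _ h1 h2
    exact absurd h1 (lt_asymm h2)
  · have n1 := p1.imp (S := fun i j => i ≠ j) (by rintro a b h rfl; exact lt_irrefl _ h)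
    have n2 := p2.imp (S := fun i j => i ≠ j) (by rintro a b h rfl; exact lt_irrefl _ h)
    rw [List.perm_ext_iff_of_nodup n1 n2]
    intro a
    simp only [List.mem_ofFn, List.mem_flatMap, List.mem_finRange, true_and, List.mem_filter]
    constructor
    · intro _; exact ⟨w a, by simp⟩
    · intro _; exact ⟨σ.symm a, by simp⟩

theorem code_eq {m N : ℕ} (w : Fin N → Fin m) :
    List.ofFn (lehmer (fun i => (stdPerm w)⁻¹ i)) = (codeAll 0 m (L (ext w) N)).reverse := by
  have h1 : List.ofFn (lehmer (fun i => (stdPerm w)⁻¹ i)) =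
      (List.ofFn (fun i => (stdPerm w)⁻¹ i)).map (fun i : Fin N => gN (ext w) i) := by
    rw [List.map_ofFn]
    congr 1
    funext p
    exact lehmer_sort w p
  rw [h1, ofFn_sort, codeAll_reverse, List.map_flatMap, ← List.range_eq_range',
    ← List.map_coe_finRange_eq_range, List.flatMap_map]
  congr 1
  funext a
  rw [codeL_L, List.reverse_reverse, ← List.map_coe_finRange_eq_range, List.filter_map,
    List.map_map]
  congr 1
  apply List.filter_congr
  intro i _
  simp [ext_val, Fin.ext_iff]

theorem inv_eq {m N : ℕ} (w : Fin N → Fin m) :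
    invStat w = (codeAll 0 m (L (ext w) N)).sum := by
  rw [← List.sum_reverse, ← code_eq, List.sum_ofFn]
  have h1 : ∀ p, lehmer (fun i => (stdPerm w)⁻¹ i) p = gN (ext w) ((stdPerm w)⁻¹ p) := lehmer_sort w
  rw [Finset.sum_congr rfl (fun p _ => h1 p),
    Equiv.sum_comp ((stdPerm w)⁻¹) (fun i : Fin N => gN (ext w) i)]
  rw [invStat, ← Finset.univ_product_univ, Finset.card_filter, Finset.sum_product_right]
  apply Finset.sum_congr rfl
  intro i _
  rw [← Finset.card_filter]
  have e : gN (ext w) i = ((Finset.range i).filter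
      (fun j => ext w i < ext w j)).card := by
    rw [gN, List.countP_eq_length_filter]
    rfl
  rw [e]
  apply Finset.card_bij (fun (j : Fin N) _ => (j : ℕ))
  · intro j hj
    simpa [ext_val] using hj
  · intro a _ b _ h
    exact Fin.ext h
  · intro b hb
    simp only [Finset.mem_filter, Finset.mem_range] at hb
    have hbN : b < N := hb.1.trans i.2
    refine ⟨⟨b, hbN⟩, ?_, rfl⟩
    have h3 := ext_val w ⟨b, hbN⟩
    simp only at h3
    rw [h3, ext_val] at hb
    rw [Finset.mem_filter]
    exact ⟨Finset.mem_univ _, hb.1, hb.2⟩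

theorem L_ext {m N : ℕ} (w : Fin N → Fin m) :
    L (ext w) N = (List.ofFn (fun i => (w i : ℕ))).reverse := by
  rw [L, ← List.map_coe_finRange_eq_range, List.map_map, List.ofFn_eq_map]
  congr 2
  funext i
  exact ext_val w i

theorem count_L {m N : ℕ} (w : Fin N → Fin m) (a : ℕ) :
    (L (ext w) N).count a = (Finset.univ.filter fun i => (w i : ℕ) = a).card := by
  rw [L_ext, List.count_reverse, List.ofFn_eq_map, List.count, List.countP_map,
    List.countP_eq_length_filter]
  have : (Finset.univ.filter fun i : Fin N => (w i : ℕ) = a) =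
    ((List.finRange N).filter (fun i => (w i : ℕ) = a)).toFinset := by
    ext i; simp
  rw [this, List.toFinset_card_of_nodup ((List.nodup_finRange N).filter _)]
  congr 1

theorem perms_eq_words (m N : ℕ) (rho : Fin m → ℕ) (hN : ∑ j, rho j = N) :
    (multisetPerms m N rho).val.map (fun w => L (ext w) N) =
      ((words 0 (List.ofFn rho) : List (List ℕ)) : Multiset (List ℕ)) := by
  obtain ⟨hnd, hmem⟩ := words_spec (List.ofFn rho) 0
  have hinj : Function.Injective (fun w : Fin N → Fin m => L (ext w) N) := by
    intro w w' h
    simp only [L_ext, List.reverse_inj, List.ofFn_inj] at h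
    funext i
    exact Fin.ext (congrFun h i)
  rw [Multiset.Nodup.ext ((multisetPerms m N rho).nodup.map hinj) (Multiset.coe_nodup.2 hnd)]
  intro l
  rw [Multiset.mem_coe, hmem, Multiset.mem_map]
  constructor
  · rintro ⟨w, hw, rfl⟩ a
    rw [Finset.mem_val, multisetPerms, Finset.mem_filter] at hw
    rw [count_L, if_pos (by omega)]
    by_cases ha : a < m
    · have := hw.2 ⟨a, ha⟩
      simp only [Fin.ext_iff] at this
      rw [this]
      simp [ha]
    · rw [List.getD_eq_default _ _ (by simp; omega), Finset.card_eq_zero,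
        Finset.filter_eq_empty_iff]
      intro i _ h
      have := (w i).2
      omega
  · intro h
    have hlen : l.length = N := by
      rw [words_length ((hmem l).2 h), List.sum_ofFn, hN]
    have hlt : ∀ a ∈ l, a < m := by
      intro a ha
      have h1 := List.count_pos_iff.2 ha
      rw [h a, if_pos (by omega)] at h1
      by_contra hge
      rw [List.getD_eq_default _ _ (by simp; omega)] at h1
      omega
    have hL : ∃ w : Fin N → Fin m, L (ext w) N = l := by
      subst hlen
      refine ⟨fun i => ⟨l.reverse[i]'(by simp), hlt _ (by
        rw [← List.mem_reverse]; exact List.getElem_mem _)⟩, ?_⟩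
      rw [L_ext, List.reverse_eq_iff]
      apply List.ext_getElem
      · simp
      · intro i h1 h2
        simp
    obtain ⟨w, rfl⟩ := hL
    refine ⟨w, ?_, rfl⟩
    rw [Finset.mem_val, multisetPerms, Finset.mem_filter]
    refine ⟨Finset.mem_univ _, fun j => ?_⟩
    have := h j
    rw [count_L] at this
    simp only [Fin.ext_iff]
    rw [this]
    simp

theorem sum_perms (m N : ℕ) (rho : Fin m → ℕ) (hN : ∑ j, rho j = N) (f : List ℕ → PP) :
    ∑ w ∈ multisetPerms m N rho, f (L (ext w) N) = ((words 0 (List.ofFn rho)).map f).sum := by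
  rw [← Multiset.sum_coe, ← Multiset.map_coe, ← perms_eq_words m N rho hN, Multiset.map_map]
  rfl

end MstcAux

/-- The pair `(mstc, inv)`, where `mstc w = stc ((std w)⁻¹)`, is equidistributed with
`(des, maj)` on multiset permutations. -/
theorem mstc_inv_equidistributed_des_maj
    (m N : ℕ) (rho : Fin m → ℕ) (hpos : ∀ j, 0 < rho j) (hN : ∑ j, rho j = N) :
    ∑ w ∈ multisetPerms m N rho,
        xP ^ stcStat (fun i => (stdPerm w)⁻¹ i) * qP ^ invStat w =
      ∑ w ∈ multisetPerms m N rho, xP ^ desStat w * qP ^ majStat w := by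
  have h1 := MstcAux.main_words qP (List.ofFn rho) 0 (fun s => xP ^ s)
  rw [← MstcAux.sum_perms m N rho hN, ← MstcAux.sum_perms m N rho hN, List.length_ofFn] at h1
  rw [Finset.sum_congr rfl (fun w _ => ?_), h1]
  · apply Finset.sum_congr rfl
    intro w _
    have h2 := MstcAux.des_maj_L (MstcAux.ext w) N
    rw [desStat, majStat, MstcAux.desSet_eq, h2.1, h2.2, mul_comm]
  · rw [MstcAux.inv_eq, stcStat, MstcAux.stcWord_eq, MstcAux.code_eq, List.reverse_reverse,
      mul_comm]
end
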